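/- Let A ∈ ℝ_max^{n×n}, let 2 ≤ g ≤ n, and let A_1, B_1, A_2 be defined from A and g as specified. Assume A_2 < CSR[A_1], that C(A) is strongly connected and contains the cycle 1 2 ⋯ g 1, that g and n are coprime, and that λ(A)·(j−i−1) + (B_1)_{ij} < (A_1^{j−i})_{ij} whenever j > i+1, i > g and j ≡ i+1 (mod g). Then CS^tR[A_1] = CS^tR[A_1 ⊕ B_1] for all t. -/

import Mathlib

open scoped Classical

noncomputable section

/-- The max-plus semiring carrier: `ℝ ∪ {-∞}`. `max` is the semiring addition `⊕`
and `+` (with `⊥` absorbing) is the semiring multiplication `⊗`. -/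
abbrev Rmax : Type := WithBot ℝ

/-- Square max-plus matrices. -/
abbrev Mat (n : ℕ) : Type := Fin n → Fin n → Rmax

namespace MaxPlus

variable {n : ℕ}

/-- Entrywise max-plus sum of matrices. -/
def oplus (A B : Mat n) : Mat n := fun i j => max (A i j) (B i j)

/-- Max-plus matrix product. -/
def mul (A B : Mat n) : Mat n := fun i j => Finset.univ.sup fun k => A i k + B k j

/-- Max-plus identity matrix. -/
def idm : Mat n := fun i j => if i = j then 0 else ⊥

/-- Max-plus matrix power. -/
def pow (A : Mat n) : ℕ → Mat n
  | 0 => idm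
  | t + 1 => mul A (pow A t)

/-- The arc relation of the digraph `D(A)`. -/
def arc (A : Mat n) (i j : Fin n) : Prop := A i j ≠ ⊥

/-- `W` is a walk of the digraph with arc relation `R` (a nonempty list of nodes,
consecutive nodes joined by arcs). -/
def IsWalk (R : Fin n → Fin n → Prop) (W : List (Fin n)) : Prop := W ≠ [] ∧ W.Chain' R

/-- `W` is a walk from `i` to `j`. -/
def IsWalkFrom (R : Fin n → Fin n → Prop) (W : List (Fin n)) (i j : Fin n) : Prop :=
  IsWalk R W ∧ W.head? = some i ∧ W.getLast? = some j

/-- The length of a walk: its number of arcs (= number of nodes minus one). -/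
def len (W : List (Fin n)) : ℕ := W.length - 1

/-- The weight `p(W)` of a walk: the max-plus product (= sum) of its arc weights. -/
def weight (A : Mat n) (W : List (Fin n)) : Rmax :=
  ((W.zip W.tail).map fun p => A p.1 p.2).sum

/-- A cycle: a closed walk of positive length with no proper closed subwalk. -/
def IsCycle (R : Fin n → Fin n → Prop) (W : List (Fin n)) : Prop :=
  2 ≤ W.length ∧ W.Chain' R ∧ W.head? = W.getLast? ∧ W.dropLast.Nodup

/-- The mean weight of a cycle: its weight divided by its length. -/
def mean (A : Mat n) (W : List (Fin n)) : Rmax :=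
  (weight A W).map fun r => r / (len W : ℝ)

/-- The maximum cycle mean `λ(A)` (equal to `⊥ = -∞` if there are no cycles). -/
def lam (A : Mat n) : Rmax := sSup {m | ∃ W, IsCycle (arc A) W ∧ m = mean A W}

/-- A critical cycle: a cycle of `D(A)` attaining the maximum cycle mean. -/
def IsCritCycle (A : Mat n) (W : List (Fin n)) : Prop :=
  IsCycle (arc A) W ∧ mean A W = lam A

/-- A node of the critical graph `C(A)`. -/
def critNode (A : Mat n) (i : Fin n) : Prop := ∃ W, IsCritCycle A W ∧ i ∈ W

/-- An arc of the critical graph `C(A)`. -/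
def critArc (A : Mat n) (i j : Fin n) : Prop :=
  ∃ W, IsCritCycle A W ∧ (i, j) ∈ W.zip W.tail

/-- Reachability in the digraph with arc relation `R`. -/
def reach (R : Fin n → Fin n → Prop) (i j : Fin n) : Prop := ∃ W, IsWalkFrom R W i j

/-- `i` and `j` lie in the same strongly connected component. -/
def sameSCC (R : Fin n → Fin n → Prop) (i j : Fin n) : Prop := reach R i j ∧ reach R j i

/-- `i` lies on some cycle of the digraph. -/
def onCycle (R : Fin n → Fin n → Prop) (i : Fin n) : Prop := ∃ W, IsCycle R W ∧ i ∈ W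

/-- The girth of the strongly connected component of `i`: the minimal length of a
cycle meeting that component. -/
def girthAt (R : Fin n → Fin n → Prop) (i : Fin n) : ℕ :=
  sInf {t | ∃ W, IsCycle R W ∧ (∃ v ∈ W, sameSCC R i v) ∧ len W = t}

/-- The maximal girth of a (completely reducible) digraph: the maximum of the girths
of its strongly connected components. -/
def maxGirth (R : Fin n → Fin n → Prop) : ℕ :=
  sSup {g | ∃ i, onCycle R i ∧ girthAt R i = g}

/-- The gcd of the cycle lengths in the strongly connected component of `i`
(described as the greatest common divisor of all such cycle lengths). -/
def sccGcd (R : Fin n → Fin n → Prop) (i : Fin n) : ℕ :=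
  sSup {d | ∀ W, IsCycle R W → (∃ v ∈ W, sameSCC R i v) → d ∣ len W}

/-- The cyclicity of a (completely reducible) digraph: the lcm over its strongly
connected components of the gcds of their cycle lengths. -/
def cyclicity (R : Fin n → Fin n → Prop) : ℕ :=
  (Finset.univ.filter fun i => onCycle R i).lcm (sccGcd R)

/-- Kleene star `X^* = I ⊕ X ⊕ ⋯ ⊕ X^{n-1}`. -/
def star (A : Mat n) : Mat n := fun i j => (Finset.range n).sup fun k => pow A k i j

/-- Scalar (max-plus) multiplication of a matrix. -/
def smul (c : Rmax) (A : Mat n) : Mat n := fun i j => c + A i j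

/-- Max-plus negation (inversion) of a scalar. -/
def negB : Rmax → Rmax := WithBot.map Neg.neg

/-- The CSR term `CS^tR[A]`. -/
def csr (A : Mat n) (t : ℕ) : Mat n :=
  if lam A = ⊥ then fun _ _ => ⊥ else
    let M := star (pow (smul (negB (lam A)) A) (cyclicity (critArc A)))
    let C : Mat n := fun i j => if critNode A j then M i j else ⊥
    let S : Mat n := fun i j => if critArc A i j then A i j else ⊥
    let R : Mat n := fun i j => if critNode A i then M i j else ⊥
    mul C (mul (pow S t) R)

/-- The Nachtigall matrix `B_N`: entries with a critical index are set to `-∞`. -/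
def bN (A : Mat n) : Mat n := fun i j => if critNode A i ∨ critNode A j then ⊥ else A i j

/-- The weak CSR threshold `T₁(A) = T₁(A, B_N)`. -/
def T1 (A : Mat n) : ℕ :=
  sInf {T | ∀ t, T ≤ t → pow A t = oplus (csr A t) (pow (bN A) t)}

/-- The Dulmage–Mendelsohn bound `DM(g,n) = g(n-2) + n`. -/
def DM (g N : ℕ) : ℕ := g * (N - 2) + N

/-- The Wielandt bound `Wi(n)`. -/
def Wi (N : ℕ) : ℕ := if N = 1 then 0 else (N - 1) ^ 2 + 1

/-- The matrix `A₁` (0-indexed version of Equation (5) of the paper): it keeps the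
arcs `(i,i+1)` for `1 ≤ i ≤ n-1`, `(n,1)` and `(g,1)` of `A` (in 1-indexed terms). -/
def A1 (A : Mat n) (g : ℕ) : Mat n := fun i j =>
  if j.val = i.val + 1 ∨ (i.val = n - 1 ∧ j.val = 0) ∨ (i.val = g - 1 ∧ j.val = 0)
  then A i j else ⊥

/-- The matrix `B₁`: it keeps the arcs `(i,j)` with `i > g`, `j > g`,
`j ≡ i+1 (mod g)` (in 1-indexed terms). -/
def B1 (A : Mat n) (g : ℕ) : Mat n := fun i j =>
  if g ≤ i.val ∧ g ≤ j.val ∧ j.val % g = (i.val + 1) % g then A i j else ⊥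

/-- The matrix `A₂`: the remaining entries of `A`. -/
def A2 (A : Mat n) (g : ℕ) : Mat n := fun i j =>
  if oplus (A1 A g) (B1 A g) i j ≠ ⊥ then ⊥ else A i j

/-- Strict domination of matrices: `X < Y` entrywise, equality allowed only at `-∞`. -/
def mLt (X Y : Mat n) : Prop := ∀ i j, X i j < Y i j ∨ (X i j = ⊥ ∧ Y i j = ⊥)

/-- The cycle `1 2 ⋯ g 1` (0-indexed: the node list `[0,1,…,g-1,0]`). -/
def stdCyc (N g : ℕ) : List (Fin N) := (List.finRange N).take g ++ (List.finRange N).take 1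

/-- The node list of the walk `(g+1)⋯n(1⋯n)^g` (0-indexed). -/
def wInteresting (N g : ℕ) : List (Fin N) :=
  (List.finRange N).drop g ++ (List.replicate g (List.finRange N)).flatten

/-- The node list of the walk `n(1⋯(n-1))^{n-1}1⋯n` (0-indexed). -/
def wWielandt (N : ℕ) : List (Fin N) :=
  (List.finRange N).drop (N - 1) ++
    (List.replicate (N - 1) ((List.finRange N).take (N - 1))).flatten ++ List.finRange N

/-- Walks from `i` to `j` through a node of `Z₀` whose length is `≡ m (mod γ)`. -/
def ThroughSet (A : Mat n) (Z0 : List (Fin n)) (i j : Fin n) (γ m : ℕ) :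
    Set (List (Fin n)) :=
  {V | IsWalkFrom (arc A) V i j ∧ (∃ v ∈ V, v ∈ Z0) ∧ len V % γ = m % γ}

/-- A twice optimal walk: of minimal length among the walks of maximal weight in
`ThroughSet A Z0 i j γ m`. -/
def TwiceOpt (A : Mat n) (Z0 : List (Fin n)) (i j : Fin n) (γ m : ℕ)
    (W : List (Fin n)) : Prop :=
  W ∈ ThroughSet A Z0 i j γ m ∧
  (∀ V ∈ ThroughSet A Z0 i j γ m, weight A V ≤ weight A W) ∧
  (∀ V ∈ ThroughSet A Z0 i j γ m, weight A V = weight A W → len W ≤ len V)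

/-- An interesting walk: twice optimal (for residue `DM(g,n) - 1` modulo `g`) of
length `DM(g,n) + g - 1`. -/
def Interesting (A : Mat n) (g : ℕ) (Z0 : List (Fin n)) (i j : Fin n)
    (W : List (Fin n)) : Prop :=
  TwiceOpt A Z0 i j g (DM g n - 1) W ∧ len W = DM g n + g - 1

/-- The index of a digraph: the transient of its Boolean adjacency matrix. -/
def Tind (R : Fin n → Fin n → Prop) : ℕ :=
  sInf {T | ∀ t, T ≤ t → ∀ i j : Fin n,
    (∃ W, IsWalkFrom R W i j ∧ len W = t) ↔
      (∃ W, IsWalkFrom R W i j ∧ len W = t + cyclicity R)}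

/-- The transient of row `i` of `A`. -/
def rowTrans (A : Mat n) (i : Fin n) : ℕ :=
  sInf {T | ∀ t, T ≤ t → ∀ j, pow A t i j = csr A t i j}

/-- The transient of column `i` of `A`. -/
def colTrans (A : Mat n) (i : Fin n) : ℕ :=
  sInf {T | ∀ t, T ≤ t → ∀ j, pow A t j i = csr A t j i}

/-- The maximum of the transients of the critical rows and columns of `A`. -/
def critTransMax (A : Mat n) : ℕ :=
  (Finset.univ.filter fun i => critNode A i).sup fun i =>
    max (rowTrans A i) (colTrans A i)

/-- Renumbering of the nodes of `A` by a permutation `σ`. -/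
def renum (σ : Equiv.Perm (Fin n)) (A : Mat n) : Mat n := fun i j => A (σ i) (σ j)

end MaxPlus

namespace MaxPlus

variable {n : ℕ}

/-! ### Matrix powers -/

theorem le_mul_apply (A B : Mat n) (i k j : Fin n) : A i k + B k j ≤ mul A B i j :=
  Finset.le_sup (f := fun k => A i k + B k j) (Finset.mem_univ k)

theorem exists_mul_apply_eq (A B : Mat n) (i j : Fin n) : ∃ k, mul A B i j = A i k + B k j := by
  obtain ⟨k, -, hk⟩ := Finset.exists_mem_eq_sup Finset.univ ⟨i, Finset.mem_univ i⟩
    (fun k => A i k + B k j)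
  exact ⟨k, hk⟩

theorem mul_apply_le {A B : Mat n} {i j : Fin n} {b : Rmax} (h : ∀ k, A i k + B k j ≤ b) :
    mul A B i j ≤ b :=
  Finset.sup_le fun k _ => h k

theorem pow_zero_self (A : Mat n) (i : Fin n) : pow A 0 i i = 0 := by simp [pow, idm]

theorem pow_zero_ne (A : Mat n) {i j : Fin n} (h : i ≠ j) : pow A 0 i j = ⊥ := by
  simp [pow, idm, h]

theorem pow_add_le (A : Mat n) (s t : ℕ) (i k j : Fin n) :
    pow A s i k + pow A t k j ≤ pow A (s + t) i j := by
  induction s generalizing i with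
  | zero =>
    by_cases h : i = k
    · subst h; simp [pow_zero_self]
    · simp [pow_zero_ne A h]
  | succ s ih =>
    obtain ⟨m, hm⟩ := exists_mul_apply_eq A (pow A s) i k
    rw [show s + 1 + t = (s + t) + 1 by ring]
    change mul A (pow A s) i k + _ ≤ mul A (pow A (s + t)) i j
    rw [hm, add_assoc]
    exact (add_le_add le_rfl (ih m)).trans (le_mul_apply _ _ _ _ _)

theorem exists_pow_add (A : Mat n) (s t : ℕ) (i j : Fin n) :
    ∃ k, pow A (s + t) i j ≤ pow A s i k + pow A t k j := by
  induction s generalizing i with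
  | zero => exact ⟨i, by simp [pow_zero_self]⟩
  | succ s ih =>
    obtain ⟨m, hm⟩ := exists_mul_apply_eq A (pow A (s + t)) i j
    obtain ⟨k, hk⟩ := ih m
    refine ⟨k, ?_⟩
    rw [show s + 1 + t = (s + t) + 1 by ring]
    change mul A (pow A (s + t)) i j ≤ _
    rw [hm]
    refine (add_le_add le_rfl hk).trans ?_
    rw [← add_assoc]
    exact add_le_add (le_mul_apply A (pow A s) i m k) le_rfl

theorem pow_add (A : Mat n) (s t : ℕ) : pow A (s + t) = mul (pow A s) (pow A t) := by
  funext i j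
  refine le_antisymm ?_ (mul_apply_le fun k => pow_add_le A s t i k j)
  obtain ⟨k, hk⟩ := exists_pow_add A s t i j
  exact hk.trans (le_mul_apply _ _ _ _ _)

theorem pow_one (A : Mat n) : pow A 1 = A := by
  funext i j
  refine le_antisymm (mul_apply_le fun k => ?_) ?_
  · by_cases h : k = j
    · subst h; simp [pow_zero_self]
    · simp [pow_zero_ne A h]
  · have h := le_mul_apply A (pow A 0) i j j
    rwa [pow_zero_self, add_zero] at h

theorem pow_pow (A : Mat n) (s k : ℕ) : pow (pow A s) k = pow A (s * k) := by
  induction k with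
  | zero => rfl
  | succ k ih =>
    rw [show s * (k + 1) = s + s * k by ring, pow_add A s, ← ih]; rfl

theorem pow_mono {A B : Mat n} (h : ∀ i j, A i j ≤ B i j) (t : ℕ) (i j : Fin n) :
    pow A t i j ≤ pow B t i j := by
  induction t generalizing i with
  | zero => exact le_rfl
  | succ t ih =>
    exact mul_apply_le fun k => (add_le_add (h i k) (ih k)).trans (le_mul_apply B (pow B t) i k j)

theorem pow_succ_le (A : Mat n) (t : ℕ) (i k j : Fin n) :
    pow A t i k + A k j ≤ pow A (t + 1) i j := by
  simpa [pow_one] using pow_add_le A t 1 i k j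

theorem exists_pow_succ (A : Mat n) (t : ℕ) (i j : Fin n) :
    ∃ k, pow A (t + 1) i j ≤ pow A t i k + A k j := by
  simpa [pow_one] using exists_pow_add A t 1 i j

/-- The entries of `A` shifted by `-c`. -/
def shift (c : ℝ) (A : Mat n) : Mat n := smul (negB (c : Rmax)) A

theorem shift_apply (c : ℝ) (A : Mat n) (i j : Fin n) :
    shift c A i j = ((-c : ℝ) : Rmax) + A i j := rfl

theorem shift_eq_bot {c : ℝ} {A : Mat n} {i j : Fin n} : shift c A i j = ⊥ ↔ A i j = ⊥ := by
  simp [shift_apply]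

theorem shift_mono {A B : Mat n} (c : ℝ) (h : ∀ i j, A i j ≤ B i j) (i j : Fin n) :
    shift c A i j ≤ shift c B i j := by
  rw [shift_apply, shift_apply]; exact add_le_add le_rfl (h i j)

theorem add_shift (c : ℝ) (A : Mat n) (i j : Fin n) :
    (c : Rmax) + shift c A i j = A i j := by
  rw [shift_apply, ← add_assoc, ← WithBot.coe_add]; simp

theorem pow_eq_add_pow_shift (c : ℝ) (A : Mat n) (t : ℕ) (i j : Fin n) :
    pow A t i j = ((t * c : ℝ) : Rmax) + pow (shift c A) t i j := by
  induction t generalizing i with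
  | zero => simp [pow]
  | succ t ih =>
    have key : ∀ k, A i k + pow A t k j =
        (((t + 1 : ℕ) * c : ℝ) : Rmax) + (shift c A i k + pow (shift c A) t k j) := by
      intro k
      rw [ih, ← add_shift c A i k]
      have : (((t + 1 : ℕ) * c : ℝ) : Rmax) = (c : Rmax) + ((t * c : ℝ) : Rmax) := by
        rw [← WithBot.coe_add, WithBot.coe_inj]; push_cast; ring
      rw [this]; abel
    refine le_antisymm (mul_apply_le fun k => ?_) ?_
    · rw [key]
      exact add_le_add le_rfl (le_mul_apply _ _ _ _ _)
    · obtain ⟨k, hk⟩ := exists_mul_apply_eq (shift c A) (pow (shift c A) t) i j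
      change _ + mul (shift c A) (pow (shift c A) t) i j ≤ _
      rw [hk, ← key]
      exact le_mul_apply A (pow A t) i k j

/-! ### Walks as lists -/

theorem zip_tail_append (l₁ l₂ : List (Fin n)) (x : Fin n) :
    (l₁ ++ x :: l₂).zip (l₁ ++ x :: l₂).tail =
      (l₁ ++ [x]).zip (l₁ ++ [x]).tail ++ (x :: l₂).zip (x :: l₂).tail := by
  induction l₁ with
  | nil => simp
  | cons a l ih => cases l <;> simp_all

theorem weight_append (A : Mat n) (l₁ l₂ : List (Fin n)) (x : Fin n) :
    weight A (l₁ ++ x :: l₂) = weight A (l₁ ++ [x]) + weight A (x :: l₂) := by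
  simp only [weight]
  rw [zip_tail_append, List.map_append, List.sum_append]

theorem weight_cons_cons (A : Mat n) (i j : Fin n) (l : List (Fin n)) :
    weight A (i :: j :: l) = A i j + weight A (j :: l) := by
  simp [weight]

theorem weight_singleton (A : Mat n) (i : Fin n) : weight A [i] = 0 := by simp [weight]

theorem weight_congr {A B : Mat n} {W : List (Fin n)}
    (h : ∀ p ∈ W.zip W.tail, A p.1 p.2 = B p.1 p.2) : weight A W = weight B W := by
  unfold weight
  rw [List.map_congr_left h]

theorem weight_mono {A B : Mat n} (h : ∀ i j, A i j ≤ B i j) (W : List (Fin n)) :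
    weight A W ≤ weight B W :=
  List.sum_le_sum fun p _ => h p.1 p.2

theorem weight_le_pow (A : Mat n) (l : List (Fin n)) (i j : Fin n)
    (h : (i :: l).getLast? = some j) : weight A (i :: l) ≤ pow A l.length i j := by
  induction l generalizing i with
  | nil =>
    obtain rfl : i = j := by simpa using h
    simp [weight_singleton, pow_zero_self]
  | cons k l ih =>
    rw [weight_cons_cons]
    exact (add_le_add le_rfl (ih k (by simpa using h))).trans
      (le_mul_apply A (pow A l.length) i k j)

theorem exists_weight_eq_pow (A : Mat n) (t : ℕ) (i j : Fin n) :
    ∃ l : List (Fin n), l.length = t ∧ pow A (t + 1) i j = weight A (i :: l ++ [j]) := by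
  induction t generalizing i with
  | zero => exact ⟨[], rfl, by simp [pow_one, weight_cons_cons, weight_singleton]⟩
  | succ t ih =>
    obtain ⟨k, hk⟩ := exists_mul_apply_eq A (pow A (t + 1)) i j
    obtain ⟨l, hl, hw⟩ := ih k
    refine ⟨k :: l, by simp [hl], ?_⟩
    change mul A (pow A (t + 1)) i j = _
    rw [hk, hw]
    exact (weight_cons_cons A i k (l ++ [j])).symm

theorem exists_split_of_mem_zip_tail {W : List (Fin n)} {i j : Fin n}
    (h : (i, j) ∈ W.zip W.tail) : ∃ l₁ l₂, W = l₁ ++ i :: j :: l₂ := by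
  induction W with
  | nil => simp at h
  | cons a l ih =>
    cases l with
    | nil => simp at h
    | cons b l =>
      simp only [List.tail_cons, List.zip_cons_cons, List.mem_cons, Prod.mk.injEq] at h
      rcases h with ⟨rfl, rfl⟩ | h
      · exact ⟨[], l, rfl⟩
      · obtain ⟨l₁, l₂, e⟩ := ih (by simpa using h)
        exact ⟨a :: l₁, l₂, by rw [e]; rfl⟩

theorem isChain_of_zip_tail {R : Fin n → Fin n → Prop} {W : List (Fin n)}
    (h : ∀ p ∈ W.zip W.tail, R p.1 p.2) : W.IsChain R := by
  induction W with
  | nil => simp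
  | cons a l ih =>
    cases l with
    | nil => simp
    | cons b l =>
      rw [List.isChain_cons_cons]
      refine ⟨h (a, b) (by simp), ih fun p hp => h p ?_⟩
      simp only [List.tail_cons, List.zip_cons_cons, List.mem_cons]
      exact Or.inr (by simpa using hp)

theorem ne_bot_of_weight_ne_bot {A : Mat n} {W : List (Fin n)} (h : weight A W ≠ ⊥) :
    W.IsChain (arc A) := by
  apply isChain_of_zip_tail
  rintro ⟨i, j⟩ hp hb
  obtain ⟨l₁, l₂, rfl⟩ := exists_split_of_mem_zip_tail hp
  apply h
  rw [weight_append, weight_cons_cons, show A i j = ⊥ from hb]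
  simp

theorem weight_ne_bot_of_isChain {A : Mat n} {W : List (Fin n)} (h : W.IsChain (arc A)) :
    weight A W ≠ ⊥ := by
  induction W with
  | nil => simp [weight]
  | cons a l ih =>
    cases l with
    | nil => simp [weight_singleton]
    | cons b l =>
      rw [List.isChain_cons_cons] at h
      rw [weight_cons_cons]
      exact WithBot.add_ne_bot.2 ⟨h.1, ih h.2⟩

theorem weight_eq_add_weight_shift (c : ℝ) (A : Mat n) (W : List (Fin n)) :
    weight A W = ((len W * c : ℝ) : Rmax) + weight (shift c A) W := by
  induction W with
  | nil => simp [weight, len]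
  | cons a l ih =>
    cases l with
    | nil => simp [weight_singleton, len]
    | cons b l =>
      rw [weight_cons_cons, weight_cons_cons, ih, ← add_shift c A a b]
      have : ((len (a :: b :: l) * c : ℝ) : Rmax) =
          (c : Rmax) + ((len (b :: l) * c : ℝ) : Rmax) := by
        rw [← WithBot.coe_add, WithBot.coe_inj]; simp [len]; ring
      rw [this]; abel

theorem exists_repeat_of_not_nodup {l : List (Fin n)} (h : ¬ l.Nodup) :
    ∃ x l₁ l₂ l₃, l = l₁ ++ x :: (l₂ ++ x :: l₃) := by
  induction l with
  | nil => simp at h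
  | cons a l ih =>
    by_cases ha : a ∈ l
    · obtain ⟨l₂, l₃, rfl⟩ := List.append_of_mem ha
      exact ⟨a, [], l₂, l₃, rfl⟩
    · obtain ⟨x, l₁, l₂, l₃, e⟩ := ih (fun hl => h (List.nodup_cons.2 ⟨ha, hl⟩))
      exact ⟨x, a :: l₁, l₂, l₃, by rw [e]; rfl⟩

theorem nonneg_of_add_nonneg_left {u v : Rmax} (h : 0 ≤ u + v) (hv : v ≤ 0) : 0 ≤ u :=
  h.trans ((add_le_add le_rfl hv).trans (by simp))

theorem nonneg_of_add_nonneg_right {u v : Rmax} (h : 0 ≤ u + v) (hu : u ≤ 0) : 0 ≤ v :=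
  nonneg_of_add_nonneg_left (by rwa [add_comm] at h) hu

/-- If all cycles have nonpositive weight, so do all closed walks, and every arc of a closed walk
of weight `0` lies on a cycle of weight `0`. -/
theorem closed_walk_aux {B : Mat n}
    (hB : ∀ i l, (i :: l).Nodup → weight B (i :: l ++ [i]) ≤ 0) (N : ℕ) :
    ∀ i l, l.length = N → weight B (i :: l ++ [i]) ≤ 0 ∧
      (0 ≤ weight B (i :: l ++ [i]) → ∀ p ∈ (i :: l ++ [i]).zip (i :: l ++ [i]).tail,
        ∃ i' l', (i' :: l').Nodup ∧ p ∈ (i' :: l' ++ [i']).zip (i' :: l' ++ [i']).tail ∧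
          0 ≤ weight B (i' :: l' ++ [i'])) := by
  induction N using Nat.strong_induction_on with
  | _ N ih =>
    intro i l hl
    by_cases hn : (i :: l).Nodup
    · exact ⟨hB i l hn, fun h p hp => ⟨i, l, hn, hp, h⟩⟩
    by_cases hi : i ∈ l
    · obtain ⟨l₂, l₃, rfl⟩ := List.append_of_mem hi
      have e : i :: (l₂ ++ i :: l₃) ++ [i] = (i :: l₂) ++ i :: (l₃ ++ [i]) := by simp
      have h₂ := ih l₂.length (by simp at hl; omega) i l₂ rfl
      have h₃ := ih l₃.length (by simp at hl; omega) i l₃ rfl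
      rw [e, weight_append, zip_tail_append]
      refine ⟨add_nonpos h₂.1 h₃.1, fun h p hp => ?_⟩
      rcases List.mem_append.1 hp with hp | hp
      · exact h₂.2 (nonneg_of_add_nonneg_left h h₃.1) p hp
      · exact h₃.2 (nonneg_of_add_nonneg_right h h₂.1) p hp
    · obtain ⟨x, l₁, l₂, l₃, rfl⟩ :=
        exists_repeat_of_not_nodup (fun hl => hn (List.nodup_cons.2 ⟨hi, hl⟩))
      have h₂ := ih l₂.length (by simp at hl; omega) x l₂ rfl
      have h₃ := ih (l₁ ++ x :: l₃).length (by simp at hl ⊢; omega) i (l₁ ++ x :: l₃) rfl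
      have e : i :: (l₁ ++ x :: (l₂ ++ x :: l₃)) ++ [i] =
          (i :: l₁) ++ x :: (l₂ ++ x :: (l₃ ++ [i])) := by simp
      have e' : x :: (l₂ ++ x :: (l₃ ++ [i])) = (x :: l₂) ++ x :: (l₃ ++ [i]) := by simp
      have e'' : i :: (l₁ ++ x :: l₃) ++ [i] = (i :: l₁) ++ x :: (l₃ ++ [i]) := by simp
      rw [e'', weight_append, zip_tail_append] at h₃
      rw [e, weight_append B (i :: l₁), zip_tail_append (i :: l₁), e', weight_append B (x :: l₂),
        zip_tail_append (x :: l₂)]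
      have hw : weight B (i :: l₁ ++ [x]) +
          (weight B (x :: l₂ ++ [x]) + weight B (x :: (l₃ ++ [i]))) =
          weight B (x :: l₂ ++ [x]) +
            (weight B (i :: l₁ ++ [x]) + weight B (x :: (l₃ ++ [i]))) := by abel
      rw [hw]
      refine ⟨add_nonpos h₂.1 h₃.1, fun h p hp => ?_⟩
      simp only [List.mem_append] at hp
      have h₃' := h₃.2 (nonneg_of_add_nonneg_right h h₂.1) p
      rcases hp with hp | hp | hp
      · exact h₃' (List.mem_append_left _ (by simpa using hp))
      · exact h₂.2 (nonneg_of_add_nonneg_left h h₃.1) p (by simpa using hp)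
      · exact h₃' (List.mem_append_right _ hp)

theorem pow_self_nonpos {B : Mat n}
    (hB : ∀ i l, (i :: l).Nodup → weight B (i :: l ++ [i]) ≤ 0) (t : ℕ) (i : Fin n) :
    pow B t i i ≤ 0 := by
  cases t with
  | zero => simp [pow_zero_self]
  | succ t =>
    obtain ⟨l, hl, hw⟩ := exists_weight_eq_pow B t i i
    rw [hw]
    exact (closed_walk_aux hB t i l hl).1

theorem pow_le_star {B : Mat n} (hB : ∀ t i, pow B t i i ≤ 0) (k : ℕ) (i j : Fin n) :
    pow B k i j ≤ star B i j := by
  induction k using Nat.strong_induction_on with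
  | _ k ih =>
    by_cases hk : k < n
    · exact Finset.le_sup (f := fun k => pow B k i j) (Finset.mem_range.2 hk)
    obtain ⟨t, rfl⟩ : ∃ t, k = t + 1 := ⟨k - 1, by have := i.isLt; omega⟩
    obtain ⟨l, hl, hw⟩ := exists_weight_eq_pow B t i j
    have hnd : ¬ (i :: l ++ [j]).Nodup := by
      intro h
      have := h.length_le_card
      simp at this
      omega
    obtain ⟨x, l₁, l₂, l₃, e⟩ := exists_repeat_of_not_nodup hnd
    have hlen : t + 2 = l₁.length + l₂.length + l₃.length + 2 := by
      have := congrArg List.length e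
      simp at this; omega
    have e' : x :: (l₂ ++ x :: l₃) = (x :: l₂) ++ x :: l₃ := rfl
    rw [hw, e, weight_append B l₁, e', weight_append B (x :: l₂)]
    have h₁ : weight B (l₁ ++ [x]) ≤ pow B l₁.length i x := by
      cases l₁ with
      | nil =>
        obtain rfl : i = x := by simpa using congrArg List.head? e
        simp [weight_singleton, pow_zero_self]
      | cons a l₁ =>
        obtain rfl : i = a := by simpa using congrArg List.head? e
        simpa using weight_le_pow B (l₁ ++ [x]) i x (by simp [List.getLast?_cons])
    have h₂ : weight B (x :: l₂ ++ [x]) ≤ 0 :=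
      (weight_le_pow B (l₂ ++ [x]) x x (by simp [List.getLast?_cons])).trans (hB _ _)
    have h₃ : weight B (x :: l₃) ≤ pow B l₃.length x j := by
      apply weight_le_pow
      have := congrArg List.getLast? e
      simp [List.getLast?_append, List.getLast?_cons] at this ⊢
      exact this.symm
    calc _ ≤ pow B l₁.length i x + (0 + pow B l₃.length x j) := by gcongr
      _ ≤ pow B (l₁.length + l₃.length) i j := by rw [zero_add]; exact pow_add_le _ _ _ _ _ _
      _ ≤ _ := ih _ (by omega)

/-! ### The maximum cycle mean and the critical graph -/

theorem exists_eq_of_isCycle {R : Fin n → Fin n → Prop} {W : List (Fin n)} (h : IsCycle R W) :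
    ∃ i l, W = i :: l ++ [i] ∧ (i :: l).Nodup := by
  obtain ⟨h2, -, h3, h4⟩ := h
  rcases List.eq_nil_or_concat W with rfl | ⟨l', j, rfl⟩
  · simp at h2
  cases l' with
  | nil => simp at h2
  | cons i l =>
    obtain rfl : i = j := by simpa [List.getLast?_append, List.getLast?_cons] using h3
    rw [List.concat_eq_append] at h4 ⊢
    exact ⟨i, l, rfl, by rwa [List.dropLast_concat] at h4⟩

theorem isCycle_of_isChain {R : Fin n → Fin n → Prop} {i : Fin n} {l : List (Fin n)}
    (hn : (i :: l).Nodup) (hc : (i :: l ++ [i]).IsChain R) : IsCycle R (i :: l ++ [i]) :=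
  ⟨by simp, hc, by simp [List.getLast?_append, List.getLast?_cons],
    by rwa [List.dropLast_concat]⟩

theorem len_closed (i : Fin n) (l : List (Fin n)) : len (i :: l ++ [i]) = l.length + 1 := by
  simp [len]

theorem mean_eq_add_weight_shift (c : ℝ) (A : Mat n) (i : Fin n) (l : List (Fin n)) :
    mean A (i :: l ++ [i]) = (c : Rmax) +
      (weight (shift c A) (i :: l ++ [i])).map fun r => r / (len (i :: l ++ [i]) : ℝ) := by
  unfold mean
  rw [weight_eq_add_weight_shift c A]
  rcases h : weight (shift c A) (i :: l ++ [i]) with _ | w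
  · rfl
  · change (((len (i :: l ++ [i]) * c : ℝ) + w : ℝ) / (len (i :: l ++ [i]) : ℝ) : ℝ) =
      ((c + w / (len (i :: l ++ [i]) : ℝ) : ℝ) : Rmax)
    rw [WithBot.coe_inj, len_closed]
    field_simp

theorem mean_le_iff (c : ℝ) (A : Mat n) (i : Fin n) (l : List (Fin n)) :
    mean A (i :: l ++ [i]) ≤ c ↔ weight (shift c A) (i :: l ++ [i]) ≤ 0 := by
  rw [mean_eq_add_weight_shift c, len_closed]
  rcases h : weight (shift c A) (i :: l ++ [i]) with _ | w
  · exact iff_of_true bot_le bot_le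
  · change ((c + w / ((l.length + 1 : ℕ) : ℝ) : ℝ) : Rmax) ≤ c ↔ ((w : ℝ) : Rmax) ≤ ((0 : ℝ) : Rmax)
    rw [WithBot.coe_le_coe, WithBot.coe_le_coe, add_le_iff_nonpos_right,
      div_le_iff₀ (by positivity), zero_mul]

theorem le_mean_iff (c : ℝ) (A : Mat n) (i : Fin n) (l : List (Fin n)) :
    (c : Rmax) ≤ mean A (i :: l ++ [i]) ↔ 0 ≤ weight (shift c A) (i :: l ++ [i]) := by
  rw [mean_eq_add_weight_shift c, len_closed]
  rcases h : weight (shift c A) (i :: l ++ [i]) with _ | w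
  · exact iff_of_false (by
      change ¬ ((c : ℝ) : Rmax) ≤ ⊥
      simp) (by
      change ¬ ((0 : ℝ) : Rmax) ≤ ⊥
      simp)
  · change (c : Rmax) ≤ ((c + w / ((l.length + 1 : ℕ) : ℝ) : ℝ) : Rmax) ↔
      ((0 : ℝ) : Rmax) ≤ ((w : ℝ) : Rmax)
    rw [WithBot.coe_le_coe, WithBot.coe_le_coe, le_add_iff_nonneg_right,
      le_div_iff₀ (by positivity), zero_mul]

theorem mean_le_lam {A : Mat n} {W : List (Fin n)} (h : IsCycle (arc A) W) :
    mean A W ≤ lam A := by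
  refine le_csSup (Set.Finite.bddAbove ?_) ⟨W, h, rfl⟩
  have hf : {W : List (Fin n) | IsCycle (arc A) W}.Finite := by
    refine (List.finite_length_le (Fin n) (n + 1)).subset fun W hW => ?_
    obtain ⟨i, l, rfl, hn⟩ := exists_eq_of_isCycle hW
    have := hn.length_le_card
    simp at this ⊢
    omega
  refine (hf.image (mean A)).subset ?_
  rintro m ⟨W, hW, rfl⟩
  exact ⟨W, hW, rfl⟩

theorem arc_shift (c : ℝ) (A : Mat n) : arc (shift c A) = arc A := by
  funext i j
  simp only [arc, ne_eq, shift_eq_bot]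

theorem ne_bot_of_nonneg {u : Rmax} (h : 0 ≤ u) : u ≠ ⊥ := by
  rintro rfl
  exact absurd h (by change ¬ ((0 : ℝ) : Rmax) ≤ ⊥; simp)

theorem weight_shift_nonpos {A : Mat n} {c : ℝ} (h : lam A = c) (i : Fin n) (l : List (Fin n))
    (hn : (i :: l).Nodup) : weight (shift c A) (i :: l ++ [i]) ≤ 0 := by
  by_cases hb : weight (shift c A) (i :: l ++ [i]) = ⊥
  · rw [hb]; exact bot_le
  rw [← mean_le_iff, ← h]
  have := ne_bot_of_weight_ne_bot hb
  rw [arc_shift] at this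
  exact mean_le_lam (isCycle_of_isChain hn this)

theorem isCycle_of_weight_nonneg {A : Mat n} {c : ℝ} {i : Fin n} {l : List (Fin n)}
    (hn : (i :: l).Nodup) (h0 : 0 ≤ weight (shift c A) (i :: l ++ [i])) :
    IsCycle (arc A) (i :: l ++ [i]) := by
  have := ne_bot_of_weight_ne_bot (ne_bot_of_nonneg h0)
  rw [arc_shift] at this
  exact isCycle_of_isChain hn this

theorem lam_eq_of_weight {A : Mat n} {c : ℝ}
    (h1 : ∀ i l, (i :: l).Nodup → weight (shift c A) (i :: l ++ [i]) ≤ 0)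
    (h2 : ∃ i l, (i :: l).Nodup ∧ 0 ≤ weight (shift c A) (i :: l ++ [i])) : lam A = c := by
  obtain ⟨i, l, hn, h0⟩ := h2
  have hc := isCycle_of_weight_nonneg hn h0
  refine le_antisymm (csSup_le ⟨_, _, hc, rfl⟩ ?_) (((le_mean_iff c A i l).2 h0).trans
    (mean_le_lam hc))
  rintro m ⟨W, hW, rfl⟩
  obtain ⟨i', l', rfl, hn'⟩ := exists_eq_of_isCycle hW
  exact (mean_le_iff c A i' l').2 (h1 i' l' hn')

theorem isCritCycle_iff {A : Mat n} {c : ℝ} (h : lam A = c) (W : List (Fin n)) :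
    IsCritCycle A W ↔
      ∃ i l, W = i :: l ++ [i] ∧ (i :: l).Nodup ∧ 0 ≤ weight (shift c A) (i :: l ++ [i]) := by
  constructor
  · rintro ⟨h1, h2⟩
    obtain ⟨i, l, rfl, hn⟩ := exists_eq_of_isCycle h1
    exact ⟨i, l, rfl, hn, (le_mean_iff c A i l).1 (by rw [h2, h])⟩
  · rintro ⟨i, l, rfl, hn, h0⟩
    refine ⟨isCycle_of_weight_nonneg hn h0, ?_⟩
    rw [h]
    exact le_antisymm ((mean_le_iff c A i l).2 (weight_shift_nonpos h i l hn))
      ((le_mean_iff c A i l).2 h0)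

theorem pow_shift_self_nonpos {A : Mat n} {c : ℝ} (h : lam A = c) (t : ℕ) (i : Fin n) :
    pow (shift c A) t i i ≤ 0 :=
  pow_self_nonpos (weight_shift_nonpos h) t i

theorem critArc_of_closed_walk {A : Mat n} {c : ℝ} (h : lam A = c) {i : Fin n}
    {l : List (Fin n)} (h0 : 0 ≤ weight (shift c A) (i :: l ++ [i])) :
    ∀ p ∈ (i :: l ++ [i]).zip (i :: l ++ [i]).tail, critArc A p.1 p.2 := by
  intro p hp
  obtain ⟨i', l', hn, hp', h0'⟩ :=
    (closed_walk_aux (weight_shift_nonpos h) l.length i l rfl).2 h0 p hp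
  exact ⟨_, (isCritCycle_iff h _).2 ⟨i', l', rfl, hn, h0'⟩, hp'⟩

theorem critArc_of_nonneg {A : Mat n} {c : ℝ} (h : lam A = c) {i j : Fin n} {s : ℕ}
    (h0 : 0 ≤ shift c A i j + pow (shift c A) s j i) : critArc A i j := by
  cases s with
  | zero =>
    by_cases hij : j = i
    · subst hij
      refine critArc_of_closed_walk h (i := j) (l := []) ?_ (j, j) (by simp)
      simpa [weight_cons_cons, weight_singleton, pow_zero_self] using h0
    · rw [pow_zero_ne _ hij] at h0
      exact absurd (by simp) (ne_bot_of_nonneg h0)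
  | succ s =>
    obtain ⟨l, -, hw⟩ := exists_weight_eq_pow (shift c A) s j i
    rw [hw] at h0
    refine critArc_of_closed_walk h (i := i) (l := j :: l) ?_ (i, j) (by simp)
    exact h0.trans_eq (weight_cons_cons _ i j (l ++ [i])).symm

theorem exists_return_of_critArc {A : Mat n} {c : ℝ} (h : lam A = c) {i j : Fin n}
    (hij : critArc A i j) : ∃ s, 0 ≤ shift c A i j + pow (shift c A) s j i := by
  obtain ⟨W, hW, hp⟩ := hij
  obtain ⟨m, l, rfl, -, h0⟩ := (isCritCycle_iff h W).1 hW
  obtain ⟨l₁, l₂, e⟩ := exists_split_of_mem_zip_tail hp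
  rw [e, weight_append, weight_cons_cons] at h0
  have h₁ : weight (shift c A) (l₁ ++ [i]) ≤ pow (shift c A) l₁.length m i := by
    cases l₁ with
    | nil =>
      obtain rfl : m = i := by simpa using congrArg List.head? e
      simp [weight_singleton, pow_zero_self]
    | cons a l₁ =>
      obtain rfl : m = a := by simpa using congrArg List.head? e
      simpa using weight_le_pow (shift c A) (l₁ ++ [i]) m i (by simp [List.getLast?_cons])
  have h₂ : weight (shift c A) (j :: l₂) ≤ pow (shift c A) l₂.length j m := by
    apply weight_le_pow
    have := congrArg List.getLast? e
    simp [List.getLast?_append, List.getLast?_cons] at this ⊢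
    exact this.symm
  refine ⟨l₂.length + l₁.length, h0.trans ?_⟩
  calc _ ≤ pow (shift c A) l₁.length m i + (shift c A i j + pow (shift c A) l₂.length j m) := by
        gcongr
    _ = shift c A i j + (pow (shift c A) l₂.length j m + pow (shift c A) l₁.length m i) := by abel
    _ ≤ _ := add_le_add le_rfl (pow_add_le _ _ _ _ _ _)

theorem critArc_left {A : Mat n} {i j : Fin n} (h : critArc A i j) : critNode A i := by
  obtain ⟨W, hW, hp⟩ := h
  exact ⟨W, hW, (List.of_mem_zip hp).1⟩

theorem critArc_right {A : Mat n} {i j : Fin n} (h : critArc A i j) : critNode A j := by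
  obtain ⟨W, hW, hp⟩ := h
  exact ⟨W, hW, List.mem_of_mem_tail (List.of_mem_zip hp).2⟩

theorem ne_bot_of_critArc {A : Mat n} {c : ℝ} (h : lam A = c) {i j : Fin n}
    (hij : critArc A i j) : A i j ≠ ⊥ := by
  obtain ⟨s, hs⟩ := exists_return_of_critArc h hij
  intro hb
  rw [shift_eq_bot.2 hb] at hs
  exact absurd (by simp) (ne_bot_of_nonneg hs)

theorem isCritCycle_mono {A B : Mat n} {c : ℝ} (hAB : ∀ i j, A i j ≤ B i j) (hA : lam A = c)
    (hB : lam B = c) {W : List (Fin n)} (h : IsCritCycle A W) : IsCritCycle B W := by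
  obtain ⟨i, l, rfl, hn, h0⟩ := (isCritCycle_iff hA W).1 h
  exact (isCritCycle_iff hB _).2 ⟨i, l, rfl, hn, h0.trans (weight_mono (shift_mono c hAB) _)⟩

theorem critNode_mono {A B : Mat n} {c : ℝ} (hAB : ∀ i j, A i j ≤ B i j) (hA : lam A = c)
    (hB : lam B = c) {i : Fin n} (h : critNode A i) : critNode B i := by
  obtain ⟨W, hW, hi⟩ := h
  exact ⟨W, isCritCycle_mono hAB hA hB hW, hi⟩

theorem critArc_mono {A B : Mat n} {c : ℝ} (hAB : ∀ i j, A i j ≤ B i j) (hA : lam A = c)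
    (hB : lam B = c) {i j : Fin n} (h : critArc A i j) : critArc B i j := by
  obtain ⟨W, hW, hi⟩ := h
  exact ⟨W, isCritCycle_mono hAB hA hB hW, hi⟩

/-- A matrix below `B` with a closed walk of mean at least `λ(B)` has `λ(A) = λ(B)`. -/
theorem lam_eq_of_le {A B : Mat n} {c : ℝ} (hAB : ∀ i j, A i j ≤ B i j) (hB : lam B = c)
    {t : ℕ} {i : Fin n} (h0 : 0 ≤ pow (shift c A) (t + 1) i i) : lam A = c := by
  have h1 : ∀ i l, (i :: l).Nodup → weight (shift c A) (i :: l ++ [i]) ≤ 0 := fun i l hn =>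
    (weight_mono (shift_mono c hAB) _).trans (weight_shift_nonpos hB i l hn)
  refine lam_eq_of_weight h1 ?_
  obtain ⟨l, hl, hw⟩ := exists_weight_eq_pow (shift c A) t i i
  rw [hw] at h0
  have hmem : ∃ p, p ∈ (i :: l ++ [i]).zip (i :: l ++ [i]).tail := by
    cases l with
    | nil => exact ⟨(i, i), by simp⟩
    | cons a l => exact ⟨(i, a), by simp⟩
  obtain ⟨p, hp⟩ := hmem
  obtain ⟨i', l', hn, -, h0'⟩ := (closed_walk_aux h1 t i l hl).2 h0 p hp
  exact ⟨i', l', hn, h0'⟩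

/-! ### The CSR terms -/

/-- The part of `A` supported on the critical arcs. -/
def critPart (A : Mat n) : Mat n := fun i j => if critArc A i j then A i j else ⊥

theorem critPart_le (A : Mat n) (i j : Fin n) : critPart A i j ≤ A i j := by
  unfold critPart
  split_ifs
  · exact le_rfl
  · exact bot_le

theorem pow_critPart_self {A : Mat n} {c : ℝ} (h : lam A = c) {t : ℕ} {i : Fin n}
    (h0 : 0 ≤ pow (shift c A) t i i) : 0 ≤ pow (shift c (critPart A)) t i i := by
  cases t with
  | zero => simp [pow_zero_self]
  | succ t =>
    obtain ⟨l, hl, hw⟩ := exists_weight_eq_pow (shift c A) t i i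
    rw [hw] at h0
    have hc := critArc_of_closed_walk h h0
    have : weight (shift c A) (i :: l ++ [i]) = weight (shift c (critPart A)) (i :: l ++ [i]) :=
      weight_congr fun p hp => by simp [shift_apply, critPart, hc p hp]
    rw [this] at h0
    have h' := h0.trans (weight_le_pow _ (l ++ [i]) i i (by simp [List.getLast?_cons]))
    rwa [List.length_append, hl] at h'

theorem csr_eq_mul {A : Mat n} {c : ℝ} (h : lam A = c) (t : ℕ) :
    csr A t = mul (fun i j => if critNode A j then
        star (pow (shift c A) (cyclicity (critArc A))) i j else ⊥)
      (mul (pow (critPart A) t) (fun i j => if critNode A i then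
        star (pow (shift c A) (cyclicity (critArc A))) i j else ⊥)) := by
  unfold csr
  rw [if_neg (by rw [h]; exact WithBot.coe_ne_bot)]
  simp only [h]
  rfl

theorem exists_star_le (B : Mat n) (i j : Fin n) : ∃ k, star B i j ≤ pow B k i j := by
  obtain ⟨k, -, hk⟩ := Finset.exists_mem_eq_sup (Finset.range n)
    ⟨0, Finset.mem_range.2 (Nat.zero_lt_of_lt i.isLt)⟩ (fun k => pow B k i j)
  exact ⟨k, hk.le⟩

theorem csr_le_aux {A : Mat n} {c : ℝ} (h : lam A = c) (t : ℕ) (i j : Fin n) :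
    csr A t i j = ⊥ ∨ ∃ k l p q, critNode A k ∧
      csr A t i j ≤ ((t * c : ℝ) : Rmax) +
        (pow (shift c A) (cyclicity (critArc A) * p) i k + (pow (shift c A) t k l +
          pow (shift c A) (cyclicity (critArc A) * q) l j)) := by
  rw [csr_eq_mul h]
  set M := star (pow (shift c A) (cyclicity (critArc A))) with hM
  obtain ⟨k, hk⟩ := exists_mul_apply_eq (fun i j => if critNode A j then M i j else ⊥)
    (mul (pow (critPart A) t) (fun i j => if critNode A i then M i j else ⊥)) i j
  obtain ⟨l, hl⟩ := exists_mul_apply_eq (pow (critPart A) t)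
    (fun i j => if critNode A i then M i j else ⊥) k j
  rw [hk, hl]
  by_cases hck : critNode A k
  swap
  · left; simp [hck]
  by_cases hcl : critNode A l
  swap
  · left; simp [hcl]
  right
  obtain ⟨p, hp⟩ := exists_star_le (pow (shift c A) (cyclicity (critArc A))) i k
  obtain ⟨q, hq⟩ := exists_star_le (pow (shift c A) (cyclicity (critArc A))) l j
  rw [pow_pow] at hp hq
  refine ⟨k, l, p, q, hck, ?_⟩
  simp only [hck, hcl, if_true]
  have hS : pow (critPart A) t k l ≤ ((t * c : ℝ) : Rmax) + pow (shift c A) t k l := by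
    rw [← pow_eq_add_pow_shift]
    exact pow_mono (critPart_le A) t k l
  calc _ ≤ pow (shift c A) (cyclicity (critArc A) * p) i k +
        ((((t * c : ℝ) : Rmax) + pow (shift c A) t k l) +
          pow (shift c A) (cyclicity (critArc A) * q) l j) := by gcongr
    _ = _ := by abel

/-- If every critical node communicates with `z` along closed walks of weight `0` and of length
divisible by the cyclicity, then a CSR term is bounded by the weight of a walk through `z`. -/
theorem csr_le_walk {A : Mat n} {c : ℝ} (h : lam A = c) {z : Fin n}
    (hz : ∀ k, critNode A k → ∃ p q, cyclicity (critArc A) ∣ p + q ∧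
      0 ≤ pow (shift c A) p k z + pow (shift c A) q z k) (t : ℕ) (i j : Fin n) :
    csr A t i j = ⊥ ∨ ∃ a b, a + b ≡ t [MOD cyclicity (critArc A)] ∧
      csr A t i j ≤ ((t * c : ℝ) : Rmax) + (pow (shift c A) a i z + pow (shift c A) b z j) := by
  rcases csr_le_aux h t i j with hb | ⟨k, l, p, q, hk, hle⟩
  · exact Or.inl hb
  right
  obtain ⟨r, s, ⟨d, hd⟩, hrs⟩ := hz k hk
  set γ := cyclicity (critArc A)
  refine ⟨γ * p + r, s + (t + γ * q), ?_, hle.trans (add_le_add le_rfl ?_)⟩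
  · rw [show γ * p + r + (s + (t + γ * q)) = t + γ * (p + q) + (r + s) by ring, hd,
      add_assoc, ← mul_add]
    simp [Nat.ModEq]
  · have h1 := pow_add_le (shift c A) (γ * p) r i k z
    have h2 := pow_add_le (shift c A) s (t + γ * q) z k j
    have h3 := pow_add_le (shift c A) t (γ * q) k l j
    refine le_trans ?_ (add_le_add h1 ((add_le_add le_rfl h3).trans h2))
    calc _ = (pow (shift c A) (γ * p) i k + (pow (shift c A) t k l +
          pow (shift c A) (γ * q) l j)) + 0 := by simp
      _ ≤ (pow (shift c A) (γ * p) i k + (pow (shift c A) t k l +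
          pow (shift c A) (γ * q) l j)) + (pow (shift c A) r k z + pow (shift c A) s z k) := by
        gcongr
      _ = _ := by abel

theorem pow_mul_self_nonneg {B : Mat n} {g : ℕ} {z : Fin n} (h : 0 ≤ pow B g z z) (m : ℕ) :
    0 ≤ pow B (g * m) z z := by
  induction m with
  | zero => simp [pow_zero_self]
  | succ m ih =>
    rw [mul_add, mul_one]
    exact (add_nonneg ih h).trans (pow_add_le _ _ _ _ _ _)

/-- The weight of a walk through a node `z` on a critical closed walk, with length in the right
residue class, is bounded by the CSR term. -/
theorem walk_le_csr {A : Mat n} {c : ℝ} (h : lam A = c) {z : Fin n} {g : ℕ} (hg : 0 < g)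
    (hγ : cyclicity (critArc A) ∣ g) (h0 : 0 ≤ pow (shift c A) g z z) {a b t : ℕ}
    (hab : a + b ≡ t [MOD cyclicity (critArc A)]) (i j : Fin n) :
    ((t * c : ℝ) : Rmax) + (pow (shift c A) a i z + pow (shift c A) b z j) ≤ csr A t i j := by
  set γ := cyclicity (critArc A) with hγd
  have hγ0 : 0 < γ := Nat.pos_of_dvd_of_pos hγ hg
  have hSA : ∀ i j, shift c (critPart A) i j ≤ shift c A i j := shift_mono c (critPart_le A)
  have hS0 := pow_critPart_self h h0
  have hcrit : ∀ u v, shift c (critPart A) u v ≠ ⊥ → critArc A u v := by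
    intro u v huv
    by_contra hc
    exact huv (shift_eq_bot.2 (by simp [critPart, hc]))
  have hczv : critNode A z := by
    obtain ⟨g', rfl⟩ : ∃ g', g = g' + 1 := ⟨g - 1, by omega⟩
    obtain ⟨k, hk⟩ := exists_pow_succ (shift c (critPart A)) g' z z
    refine critArc_right (hcrit k z fun hb => ?_)
    rw [hb] at hk
    exact ne_bot_of_nonneg (hS0.trans hk) (by simp)
  have hreach : ∀ s k, pow (shift c (critPart A)) s z k ≠ ⊥ → critNode A k := by
    intro s k hs
    cases s with
    | zero =>
      by_cases hzk : z = k
      · exact hzk ▸ hczv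
      · exact absurd (pow_zero_ne _ hzk) hs
    | succ s =>
      obtain ⟨m, hm⟩ := exists_pow_succ (shift c (critPart A)) s z k
      refine critArc_right (hcrit m k fun hb => hs ?_)
      rw [hb] at hm
      simpa using hm
  obtain ⟨r, m₁, hr⟩ : ∃ r m₁, a + r = g * m₁ := ⟨g * a - a, a, by
    have := Nat.le_mul_of_pos_left a hg; omega⟩
  obtain ⟨s, m₂, hs⟩ : ∃ s m₂, r + t + s = g * m₂ := ⟨g * (r + t) - (r + t), r + t, by
    have := Nat.le_mul_of_pos_left (r + t) hg; omega⟩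
  have hsb : γ ∣ s + b := by
    have h1 : γ ∣ a + r := hr ▸ hγ.mul_right m₁
    have h2 : γ ∣ r + t + s := hs ▸ hγ.mul_right m₂
    have h3 : (γ : ℤ) ∣ t - (a + b) := by
      simpa using Nat.modEq_iff_dvd.1 hab
    zify at h1 h2 ⊢
    have := (h2.sub h1).sub h3
    ring_nf at this ⊢
    exact this
  have hm := hs ▸ pow_mul_self_nonneg hS0 m₂
  obtain ⟨v, hv⟩ := exists_pow_add (shift c (critPart A)) (r + t) s z z
  obtain ⟨u, hu⟩ := exists_pow_add (shift c (critPart A)) r t z v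
  have htot := hm.trans (hv.trans (add_le_add hu le_rfl))
  have hne := ne_bot_of_nonneg htot
  have hrv : critNode A v := hreach (r + t) v fun hb => by
    rw [hb] at hv
    exact ne_bot_of_nonneg (hm.trans hv) (by simp)
  have hru : critNode A u := hreach r u fun hb => by
    rw [hb] at hne
    exact hne (by simp)
  have hB : ∀ k i, pow (pow (shift c A) γ) k i i ≤ 0 := fun k i => by
    rw [pow_pow]; exact pow_shift_self_nonpos h _ _
  have hM : ∀ m p q, pow (shift c A) (γ * m) p q ≤ star (pow (shift c A) γ) p q := by
    intro m p q
    rw [← pow_pow]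
    exact pow_le_star hB m p q
  obtain ⟨d₁, hd₁⟩ : γ ∣ a + r := hr ▸ hγ.mul_right m₁
  obtain ⟨d₂, hd₂⟩ := hsb
  have hC : pow (shift c A) a i z + pow (shift c (critPart A)) r z u ≤
      star (pow (shift c A) γ) i u := by
    refine le_trans ?_ (hM d₁ i u)
    rw [← hd₁]
    exact (add_le_add le_rfl (pow_mono hSA r z u)).trans (pow_add_le _ _ _ _ _ _)
  have hR : pow (shift c (critPart A)) s v z + pow (shift c A) b z j ≤
      star (pow (shift c A) γ) v j := by
    refine le_trans ?_ (hM d₂ v j)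
    rw [← hd₂]
    exact (add_le_add (pow_mono hSA s v z) le_rfl).trans (pow_add_le _ _ _ _ _ _)
  rw [csr_eq_mul h, ← hγd]
  refine le_trans ?_ (le_mul_apply _ _ i u j)
  refine le_trans ?_ (add_le_add le_rfl (le_mul_apply _ _ u v j))
  simp only [hrv, hru, if_true]
  rw [pow_eq_add_pow_shift c (critPart A)]
  calc ((t * c : ℝ) : Rmax) + (pow (shift c A) a i z + pow (shift c A) b z j)
      = ((t * c : ℝ) : Rmax) + (pow (shift c A) a i z + pow (shift c A) b z j) + 0 := by simp
    _ ≤ ((t * c : ℝ) : Rmax) + (pow (shift c A) a i z + pow (shift c A) b z j) +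
        (pow (shift c (critPart A)) r z u + pow (shift c (critPart A)) t u v +
          pow (shift c (critPart A)) s v z) := by gcongr
    _ = (pow (shift c A) a i z + pow (shift c (critPart A)) r z u) +
        ((((t * c : ℝ) : Rmax) + pow (shift c (critPart A)) t u v) +
          (pow (shift c (critPart A)) s v z + pow (shift c A) b z j)) := by abel
    _ ≤ _ := by gcongr

/-! ### Cyclicity -/

theorem len_stdCyc {m : ℕ} (hn : 0 < n) (hmn : m ≤ n) : len (stdCyc n m) = m := by
  simp [len, stdCyc]; omega

theorem stdCyc_getElem {m k : ℕ} (hkn : k < n) (h : k < (stdCyc n m).length) (hk : k < m) :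
    ((stdCyc n m)[k]).val = k := by
  simp only [stdCyc]
  rw [List.getElem_append_left (by simp; omega)]
  simp

theorem stdCyc_getElem_self {m : ℕ} (h : m < (stdCyc n m).length) :
    ((stdCyc n m)[m]).val = 0 := by
  simp only [stdCyc, List.length_append, List.length_take, List.length_finRange] at h
  simp only [stdCyc]
  rw [List.getElem_append_right (by simp)]
  simp; omega

theorem isCycle_stdCyc {R : Fin n → Fin n → Prop} {m : ℕ} (hm : 0 < m) (hmn : m ≤ n)
    (h₁ : ∀ i j : Fin n, j.val = i.val + 1 → j.val < m → R i j)
    (h₂ : ∀ i j : Fin n, i.val = m - 1 → j.val = 0 → R i j) : IsCycle R (stdCyc n m) := by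
  have hlen : (stdCyc n m).length = m + 1 := by simp [stdCyc]; omega
  have htake : (List.finRange n).take 1 = [⟨0, by omega⟩] := by
    obtain ⟨k, rfl⟩ : ∃ k, n = k + 1 := ⟨n - 1, by omega⟩
    simp [List.finRange_succ]
  refine ⟨by omega, ?_, ?_, ?_⟩
  · refine List.isChain_iff_getElem.2 fun k hk => ?_
    by_cases hkm : k + 1 < m
    · refine h₁ _ _ ?_ ?_
      · rw [stdCyc_getElem (by omega) _ hkm, stdCyc_getElem (by omega) _ (by omega)]
      · rw [stdCyc_getElem (by omega) _ hkm]; exact hkm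
    · obtain rfl : m = k + 1 := by omega
      exact h₂ _ _ (stdCyc_getElem (by omega) _ (by omega)) (stdCyc_getElem_self _)
  · rw [List.head?_eq_getElem?, List.getLast?_eq_getElem?, hlen,
      List.getElem?_eq_getElem (by omega), List.getElem?_eq_getElem (by omega)]
    congr 1
    ext
    rw [stdCyc_getElem (by omega) _ hm]
    exact (stdCyc_getElem_self _).symm
  · rw [stdCyc, htake, List.dropLast_concat]
    exact (List.nodup_finRange n).sublist (List.take_sublist _ _)

theorem arc_of_isCycle_stdCyc {R : Fin n → Fin n → Prop} {m : ℕ} (hm : 0 < m) (hmn : m ≤ n)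
    (h : IsCycle R (stdCyc n m)) :
    (∀ i j : Fin n, j.val = i.val + 1 → j.val < m → R i j) ∧
    (∀ i j : Fin n, i.val = m - 1 → j.val = 0 → R i j) := by
  have hlen : (stdCyc n m).length = m + 1 := by simp [stdCyc]; omega
  have hc := List.isChain_iff_getElem.1 h.2.1
  constructor
  · intro i j hij hj
    have := hc i.val (by omega)
    convert this using 1
    · ext; rw [stdCyc_getElem (by omega) _ (by omega)]
    · ext; rw [stdCyc_getElem (by omega) _ (by omega), hij]
  · intro i j hi hj
    obtain ⟨k, rfl⟩ : ∃ k, m = k + 1 := ⟨m - 1, by omega⟩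
    have := hc k (by omega)
    convert this using 1
    · ext; rw [stdCyc_getElem (by omega) _ (by omega)]; omega
    · ext; rw [stdCyc_getElem_self, hj]

theorem mem_stdCyc {m : ℕ} {v : Fin n} (hv : v.val < m) : v ∈ stdCyc n m := by
  have hlen : v.val < (stdCyc n m).length := by
    have := v.isLt
    simp only [stdCyc, List.length_append, List.length_take, List.length_finRange]; omega
  have : v = (stdCyc n m)[v.val] := by ext; rw [stdCyc_getElem (by omega) _ hv]
  rw [this]
  exact List.getElem_mem _

theorem reach_of_reflTransGen {R : Fin n → Fin n → Prop} {i j : Fin n}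
    (h : Relation.ReflTransGen R i j) : reach R i j := by
  obtain ⟨l, hl, hj⟩ := List.exists_isChain_cons_of_relationReflTransGen h
  exact ⟨i :: l, ⟨by simp, hl⟩, rfl, by rw [List.getLast?_eq_some_getLast (by simp), hj]⟩

theorem reflTransGen_of_reach {R : Fin n → Fin n → Prop} {i j : Fin n}
    (h : reach R i j) : Relation.ReflTransGen R i j := by
  obtain ⟨W, ⟨hne, hc⟩, hi, hj⟩ := h
  cases W with
  | nil => exact absurd rfl hne
  | cons a l =>
    obtain rfl : a = i := by simpa using hi
    refine List.relationReflTransGen_of_exists_isChain_cons l hc ?_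
    rw [List.getLast?_eq_some_getLast (by simp)] at hj
    exact Option.some.inj hj

theorem sameSCC_refl (R : Fin n → Fin n → Prop) (i : Fin n) : sameSCC R i i :=
  ⟨reach_of_reflTransGen .refl, reach_of_reflTransGen .refl⟩

/-- A digraph on `n` nodes containing the Hamiltonian cycle `1⋯n1` and the cycle `1⋯g1` with
`g` and `n` coprime has cyclicity `1`. -/
theorem cyclicity_eq_one {R : Fin n → Fin n → Prop} {g : ℕ} (hg : 0 < g) (hgn : g ≤ n)
    (hcop : Nat.Coprime g n) (h₁ : IsCycle R (stdCyc n g)) (h₂ : IsCycle R (stdCyc n n)) :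
    cyclicity R = 1 := by
  have hn : 0 < n := by omega
  obtain ⟨ha, hb⟩ := arc_of_isCycle_stdCyc hn le_rfl h₂
  have hup : ∀ (d : ℕ) (i j : Fin n), j.val = i.val + d → Relation.ReflTransGen R i j := by
    intro d
    induction d with
    | zero =>
      intro i j hij
      obtain rfl : j = i := Fin.ext hij
      exact .refl
    | succ d ih =>
      intro i j hij
      have hj := j.isLt
      exact (ih i ⟨i.val + d, by omega⟩ rfl).tail (ha _ _ (by simp; omega) hj)
  let z : Fin n := ⟨0, hn⟩
  have hz : ∀ i, sameSCC R i z := fun i => by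
    have hi := i.isLt
    refine ⟨reach_of_reflTransGen ?_, reach_of_reflTransGen (hup i.val z i (by simp [z]))⟩
    exact (hup (n - 1 - i.val) i ⟨n - 1, by omega⟩ (by simp; omega)).tail (hb _ _ rfl rfl)
  have hscc : ∀ i, sccGcd R i = 1 := by
    intro i
    have : {d | ∀ W, IsCycle R W → (∃ v ∈ W, sameSCC R i v) → d ∣ len W} = {1} := by
      ext d
      simp only [Set.mem_ofPred_eq, Set.mem_singleton_iff]
      constructor
      · intro h
        have h1 := h _ h₁ ⟨z, mem_stdCyc hg, hz i⟩
        have h2 := h _ h₂ ⟨z, mem_stdCyc hn, hz i⟩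
        rw [len_stdCyc hn hgn] at h1
        rw [len_stdCyc hn le_rfl] at h2
        exact Nat.eq_one_of_dvd_coprimes hcop h1 h2
      · rintro rfl W - -
        exact one_dvd _
    rw [sccGcd, this, csSup_singleton]
  refine Nat.dvd_one.1 (Finset.lcm_dvd fun i _ => ?_)
  rw [hscc i]

/-- A digraph containing the cycle `1⋯g1`, all of whose arcs join nodes of this cycle and advance
by `1` modulo `g`, has cyclicity `g`. -/
theorem cyclicity_eq_of_mod {R : Fin n → Fin n → Prop} {g : ℕ} (hg : 0 < g) (hgn : g ≤ n)
    (h₁ : IsCycle R (stdCyc n g))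
    (hR : ∀ i j, R i j → i.val < g ∧ j.val < g ∧ j.val ≡ i.val + 1 [MOD g]) :
    cyclicity R = g := by
  have hn : 0 < n := by omega
  have hwalk : ∀ (l : List (Fin n)) (i j : Fin n), (i :: l).IsChain R →
      (i :: l).getLast? = some j → j.val ≡ i.val + l.length [MOD g] := by
    intro l
    induction l with
    | nil =>
      intro i j _ hj
      obtain rfl : i = j := by simpa using hj
      rfl
    | cons a l ih =>
      intro i j hc hj
      rw [List.isChain_cons_cons] at hc
      have h := ih a j hc.2 (by simpa using hj)
      refine h.trans ((Nat.ModEq.add_right l.length (hR i a hc.1).2.2).trans ?_)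
      rw [List.length_cons, show i.val + 1 + l.length = i.val + (l.length + 1) by ring]
  have hdvd : ∀ W, IsCycle R W → g ∣ len W := by
    intro W hW
    obtain ⟨i, l, rfl, -⟩ := exists_eq_of_isCycle hW
    have h := hwalk (l ++ [i]) i i hW.2.1 (by simp [List.getLast?_cons])
    have h' : 0 ≡ (l ++ [i]).length [MOD g] := Nat.ModEq.add_left_cancel' i.val h
    exact (Nat.modEq_zero_iff_dvd.1 h'.symm)
  have honc : ∀ i, onCycle R i → i.val < g := by
    rintro i ⟨W, hW, hi⟩
    obtain ⟨m, l, rfl, -⟩ := exists_eq_of_isCycle hW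
    have hc := hW.2.1
    have hi' : i ∈ m :: l := by simpa [or_comm] using hi
    obtain ⟨l₁, l₂, e⟩ := List.append_of_mem hi'
    rw [e, List.append_assoc, List.cons_append] at hc
    have h2 := (List.isChain_split.1 hc).2
    cases l₂ with
    | nil => exact (hR _ _ (List.isChain_cons_cons.1 h2).1).1
    | cons b l₂ => exact (hR _ _ (List.isChain_cons_cons.1 h2).1).1
  have hscc : ∀ i, onCycle R i → sccGcd R i = g := by
    intro i hi
    have hle : ∀ d ∈ {d | ∀ W, IsCycle R W → (∃ v ∈ W, sameSCC R i v) → d ∣ len W}, d ≤ g := by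
      intro d hd
      have := hd _ h₁ ⟨i, mem_stdCyc (honc i hi), sameSCC_refl R i⟩
      rw [len_stdCyc hn hgn] at this
      exact Nat.le_of_dvd hg this
    refine le_antisymm (csSup_le ⟨g, fun W hW _ => hdvd W hW⟩ hle)
      (le_csSup ⟨g, hle⟩ fun W hW _ => hdvd W hW)
  have hz : onCycle R ⟨0, hn⟩ := ⟨_, h₁, mem_stdCyc hg⟩
  refine Nat.dvd_antisymm (Finset.lcm_dvd fun i hi => ?_) ?_
  · rw [hscc i (Finset.mem_filter.1 hi).2]
  · have := Finset.dvd_lcm (f := sccGcd R)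
      (Finset.mem_filter.2 ⟨Finset.mem_univ (⟨0, hn⟩ : Fin n), hz⟩)
    rwa [hscc _ hz] at this

/-! ### Comparing walks of `A₁` and `A₁ ⊕ B₁` -/

theorem pow_split_in {Y : Mat n} (hY : ∀ i j, 0 < j.val → Y i j ≠ ⊥ → j.val = i.val + 1)
    {z : Fin n} (hz : z.val = 0) (d a : ℕ) (j k : Fin n) (hjk : k.val = j.val + d) :
    pow Y a z k = ⊥ ∨ d ≤ a ∧ pow Y a z k ≤ pow Y (a - d) z j + pow Y d j k := by
  induction d generalizing a k with
  | zero =>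
    obtain rfl : k = j := Fin.ext hjk
    exact Or.inr ⟨Nat.zero_le _, by simp [pow_zero_self]⟩
  | succ d ih =>
    cases a with
    | zero =>
      left
      apply pow_zero_ne
      rintro rfl
      omega
    | succ a =>
      obtain ⟨m, hm⟩ := exists_pow_succ Y a z k
      by_cases hb : Y m k = ⊥
      · left; simpa [hb] using hm
      have hmk := hY m k (by omega) hb
      rcases ih a m (by omega) with h | ⟨hda, h⟩
      · left; simpa [h] using hm
      refine Or.inr ⟨by omega, hm.trans ((add_le_add h le_rfl).trans ?_)⟩
      rw [add_assoc, Nat.add_sub_add_right]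
      exact add_le_add le_rfl (pow_succ_le _ _ _ _ _)

theorem pow_split_out {Y : Mat n} {g : ℕ}
    (hY : ∀ i j : Fin n, g ≤ i.val → i.val + 1 < n → Y i j ≠ ⊥ → j.val = i.val + 1)
    {z : Fin n} (hz : z.val < g) (d a : ℕ) (i k : Fin n) (hi : g ≤ i.val)
    (hik : k.val = i.val + d) :
    pow Y a i z = ⊥ ∨ d ≤ a ∧ pow Y a i z ≤ pow Y d i k + pow Y (a - d) k z := by
  induction d generalizing a i with
  | zero =>
    obtain rfl : k = i := Fin.ext hik
    exact Or.inr ⟨Nat.zero_le _, by simp [pow_zero_self]⟩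
  | succ d ih =>
    have hk := k.isLt
    cases a with
    | zero =>
      left
      apply pow_zero_ne
      rintro rfl
      omega
    | succ a =>
      obtain ⟨m, hm⟩ := exists_mul_apply_eq Y (pow Y a) i z
      change pow Y (a + 1) i z = _ at hm
      rw [hm]
      by_cases hb : Y i m = ⊥
      · left; simp [hb]
      have hmi := hY i m hi (by omega) hb
      rcases ih a m (by omega) (by omega) with h | ⟨hda, h⟩
      · left; simp [h]
      refine Or.inr ⟨by omega, (add_le_add le_rfl h).trans ?_⟩
      rw [← add_assoc, Nat.add_sub_add_right]
      exact add_le_add (le_mul_apply Y (pow Y d) i m k) le_rfl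

theorem pow_le_pow_from {Y Z V : Mat n} {g : ℕ} {z : Fin n} (hz : z.val = 0)
    (hV : ∀ t i, pow V t i i ≤ 0) (hYV : ∀ i j, Y i j ≤ V i j) (hZV : ∀ i j, Z i j ≤ V i j)
    (hY : ∀ i j, 0 < j.val → Y i j ≠ ⊥ → j.val = i.val + 1)
    (hZ : ∀ i j, Z i j ≤ Y i j ∨
      g ≤ i.val ∧ j.val ≡ i.val + 1 [MOD g] ∧ (j.val ≤ i.val ∨ i.val + 1 < j.val))
    (hf : ∀ i j : Fin n, i.val + 1 < j.val → g ≤ i.val → j.val ≡ i.val + 1 [MOD g] →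
      Z i j ≤ pow Y (j.val - i.val) i j) (b : ℕ) (j : Fin n) :
    ∃ b', b' ≡ b [MOD g] ∧ pow Z b z j ≤ pow Y b' z j := by
  induction b generalizing j with
  | zero => exact ⟨0, rfl, le_rfl⟩
  | succ b ih =>
    obtain ⟨k, hk⟩ := exists_pow_succ Z b z j
    obtain ⟨b', hb', hle⟩ := ih k
    have hk' := hk.trans (add_le_add hle le_rfl)
    rcases hZ k j with h | ⟨hgk, hmod, hjk | hjk⟩
    · exact ⟨b' + 1, hb'.add_right 1,
        hk'.trans ((add_le_add le_rfl h).trans (pow_succ_le _ _ _ _ _))⟩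
    · rcases pow_split_in hY hz (k.val - j.val) b' j k (by omega) with h | ⟨hd, h⟩
      · exact ⟨b + 1, rfl, by rw [h, WithBot.bot_add] at hk'; exact hk'.trans bot_le⟩
      · refine ⟨b' - (k.val - j.val), ?_, hk'.trans ((add_le_add h le_rfl).trans ?_)⟩
        · have h0 : k.val - j.val + 1 ≡ 0 [MOD g] := by
            refine Nat.ModEq.add_left_cancel' j.val ?_
            rw [show j.val + (k.val - j.val + 1) = k.val + 1 by omega]
            exact hmod.symm
          refine Nat.ModEq.add_right_cancel' (k.val - j.val) ?_
          rw [Nat.sub_add_cancel hd, show b + 1 + (k.val - j.val) = b + (k.val - j.val + 1) by ring]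
          exact hb'.trans (h0.add_left b).symm
        · rw [add_assoc]
          have h0 : pow Y (k.val - j.val) j k + Z k j ≤ 0 :=
            (add_le_add (pow_mono hYV _ _ _) (hZV k j)).trans
              ((pow_succ_le _ _ _ _ _).trans (hV _ _))
          exact (add_le_add le_rfl h0).trans (by simp)
    · refine ⟨b' + (j.val - k.val), hb'.add ?_,
        hk'.trans ((add_le_add le_rfl (hf k j hjk hgk hmod)).trans (pow_add_le _ _ _ _ _ _))⟩
      refine Nat.ModEq.add_left_cancel' k.val ?_
      rw [show k.val + (j.val - k.val) = j.val by omega]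
      exact hmod

theorem pow_le_pow_to {Y Z V : Mat n} {g : ℕ} {z : Fin n} (hz : z.val < g)
    (hV : ∀ t i, pow V t i i ≤ 0) (hYV : ∀ i j, Y i j ≤ V i j) (hZV : ∀ i j, Z i j ≤ V i j)
    (hY : ∀ i j : Fin n, g ≤ i.val → i.val + 1 < n → Y i j ≠ ⊥ → j.val = i.val + 1)
    (hZ : ∀ i j, Z i j ≤ Y i j ∨
      g ≤ i.val ∧ g ≤ j.val ∧ j.val ≡ i.val + 1 [MOD g] ∧ (j.val ≤ i.val ∨ i.val + 1 < j.val))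
    (hf : ∀ i j : Fin n, i.val + 1 < j.val → g ≤ i.val → j.val ≡ i.val + 1 [MOD g] →
      Z i j ≤ pow Y (j.val - i.val) i j) (a : ℕ) (i : Fin n) :
    ∃ a', a' ≡ a [MOD g] ∧ pow Z a i z ≤ pow Y a' i z := by
  induction a generalizing i with
  | zero => exact ⟨0, rfl, le_rfl⟩
  | succ a ih =>
    obtain ⟨k, hk⟩ := exists_mul_apply_eq Z (pow Z a) i z
    change pow Z (a + 1) i z = _ at hk
    obtain ⟨a', ha', hle⟩ := ih k
    have hk' := hk.le.trans (add_le_add le_rfl hle)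
    rcases hZ i k with h | ⟨hgi, hgk, hmod, hik | hik⟩
    · exact ⟨a' + 1, ha'.add_right 1,
        hk'.trans ((add_le_add h le_rfl).trans (le_mul_apply Y (pow Y a') i k z))⟩
    · rcases pow_split_out hY hz (i.val - k.val) a' k i hgk (by omega) with h | ⟨hd, h⟩
      · exact ⟨a + 1, rfl, by rw [h, WithBot.add_bot] at hk'; exact hk'.trans bot_le⟩
      · refine ⟨a' - (i.val - k.val), ?_, hk'.trans ((add_le_add le_rfl h).trans ?_)⟩
        · have h0 : i.val - k.val + 1 ≡ 0 [MOD g] := by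
            refine Nat.ModEq.add_left_cancel' k.val ?_
            rw [show k.val + (i.val - k.val + 1) = i.val + 1 by omega]
            exact hmod.symm
          refine Nat.ModEq.add_right_cancel' (i.val - k.val) ?_
          rw [Nat.sub_add_cancel hd, show a + 1 + (i.val - k.val) = a + (i.val - k.val + 1) by ring]
          exact ha'.trans (h0.add_left a).symm
        · rw [← add_assoc]
          have h0 : Z i k + pow Y (i.val - k.val) k i ≤ 0 :=
            (add_le_add (hZV i k) (pow_mono hYV _ _ _)).trans
              ((le_mul_apply V (pow V (i.val - k.val)) i k i).trans (hV (i.val - k.val + 1) i))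
          exact (add_le_add h0 le_rfl).trans (by simp)
    · refine ⟨(k.val - i.val) + a', ?_,
        hk'.trans ((add_le_add (hf i k hik hgi hmod) le_rfl).trans (pow_add_le _ _ _ _ _ _))⟩
      rw [add_comm]
      refine ha'.add (Nat.ModEq.add_left_cancel' i.val ?_)
      rw [show i.val + (k.val - i.val) = k.val by omega]
      exact hmod

/-- Consequences, for the critical graph of a matrix, of the cycle `1⋯m1` having weight at least
`m λ`. -/
theorem std_cycle_consequences {X Y : Mat n} {c : ℝ} (hX : lam X = c)
    (hYX : ∀ i j, Y i j ≤ shift c X i j)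
    (hY : ∀ i j, 0 < j.val → Y i j ≠ ⊥ → j.val = i.val + 1)
    {z p : Fin n} (hz : z.val = 0) (h0 : 0 ≤ pow Y p.val z p + Y p z) :
    (∀ k : Fin n, k.val < p.val + 1 → ∃ a b, a + b = p.val + 1 ∧
      0 ≤ pow (shift c X) a k z + pow (shift c X) b z k) ∧
    IsCycle (critArc X) (stdCyc n (p.val + 1)) := by
  have hp := p.isLt
  have hsplit : ∀ k : Fin n, k.val ≤ p.val →
      0 ≤ (pow Y k.val z k + pow Y (p.val - k.val) k p) + Y p z := by
    intro k hk
    rcases pow_split_in hY hz (p.val - k.val) p.val k p (by omega) with h | ⟨hd, h⟩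
    · rw [h, WithBot.bot_add] at h0
      exact absurd rfl (ne_bot_of_nonneg h0)
    · rw [show p.val - (p.val - k.val) = k.val by omega] at h
      exact h0.trans (add_le_add h le_rfl)
  refine ⟨fun k hk => ⟨p.val - k.val + 1, k.val, by omega, ?_⟩,
    isCycle_stdCyc (by omega) (by omega) ?_ ?_⟩
  · refine (hsplit k (by omega)).trans ?_
    rw [add_assoc, add_comm]
    exact add_le_add ((pow_succ_le _ _ _ _ _).trans (pow_mono hYX _ _ _)) (pow_mono hYX _ _ _)
  · intro i j hij hj
    have h := hsplit j (by omega)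
    rcases pow_split_in hY hz 1 j.val i j hij with hb | ⟨hd, hle⟩
    · rw [hb, WithBot.bot_add, WithBot.bot_add] at h
      exact absurd rfl (ne_bot_of_nonneg h)
    rw [pow_one] at hle
    refine critArc_of_nonneg hX (s := (p.val - j.val + 1) + (j.val - 1)) ?_
    calc (0 : Rmax) ≤ ((pow Y (j.val - 1) z i + Y i j) + pow Y (p.val - j.val) j p) + Y p z :=
          h.trans (add_le_add (add_le_add hle le_rfl) le_rfl)
      _ = Y i j + ((pow Y (p.val - j.val) j p + Y p z) + pow Y (j.val - 1) z i) := by abel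
      _ ≤ Y i j + (pow Y (p.val - j.val + 1) j z + pow Y (j.val - 1) z i) := by
        gcongr; exact pow_succ_le _ _ _ _ _
      _ ≤ _ := add_le_add (hYX i j) ((pow_add_le _ _ _ _ _ _).trans (pow_mono hYX _ _ _))
  · intro i j hi hj
    obtain rfl : i = p := Fin.ext (by omega)
    obtain rfl : j = z := Fin.ext (by omega)
    refine critArc_of_nonneg hX (s := i.val) ?_
    rw [add_comm] at h0
    exact h0.trans (add_le_add (hYX i j) (pow_mono hYX _ _ _))

/-- The critical cycle `1⋯g1` of `A` has weight at least `g λ` in a matrix agreeing with `A` on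
its arcs. -/
theorem nonneg_of_critical_std_cycle {A Y : Mat n} {c : ℝ} (hA : lam A = c) {z p : Fin n}
    (hz : z.val = 0)
    (h₁ : ∀ i j : Fin n, j.val = i.val + 1 → j.val < p.val + 1 →
      critArc A i j ∧ shift c A i j = Y i j)
    (h₂ : critArc A p z ∧ shift c A p z = Y p z) :
    0 ≤ pow Y p.val z p + Y p z := by
  have key : ∀ (k : ℕ) (i : Fin n), i.val = k → k < p.val + 1 →
      ∃ s, 0 ≤ pow Y k z i + pow (shift c A) s i z := by
    intro k
    induction k with
    | zero =>
      intro i hi _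
      obtain rfl : i = z := Fin.ext (by omega)
      exact ⟨0, by simp [pow_zero_self]⟩
    | succ k ih =>
      intro j hj hk
      have hjn := j.isLt
      let i : Fin n := ⟨k, by omega⟩
      obtain ⟨s, hs⟩ := ih i rfl (by omega)
      obtain ⟨hc, he⟩ := h₁ i j hj (by omega)
      obtain ⟨r, hr⟩ := exists_return_of_critArc hA hc
      rw [he] at hr
      refine ⟨r + s, (add_nonneg hs hr).trans ?_⟩
      calc _ = (pow Y k z i + Y i j) + (pow (shift c A) r j i + pow (shift c A) s i z) := by abel
        _ ≤ _ := add_le_add (pow_succ_le _ _ _ _ _) (pow_add_le _ _ _ _ _ _)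
  obtain ⟨s, hs⟩ := key p.val p rfl (by omega)
  obtain ⟨r, hr⟩ := exists_return_of_critArc hA h₂.1
  rw [h₂.2] at hr
  have h := add_nonneg hs hr
  have hle : pow (shift c A) r z p + pow (shift c A) s p z ≤ 0 :=
    (pow_add_le _ _ _ _ _ _).trans (pow_shift_self_nonpos hA _ _)
  refine nonneg_of_add_nonneg_left (v := pow (shift c A) r z p + pow (shift c A) s p z) ?_ hle
  exact h.trans_eq (by abel)

/-- An arc of `A` lighter than a CSR term of a matrix below `A` is not critical. -/
theorem not_critArc_of_lt_csr {A X : Mat n} {c : ℝ} (hA : lam A = c) (hX : lam X = c)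
    (hXA : ∀ i j, X i j ≤ A i j) {i j : Fin n} (h : A i j < csr X 1 i j) :
    ¬ critArc A i j := by
  intro hij
  obtain ⟨s, hs⟩ := exists_return_of_critArc hA hij
  rcases csr_le_aux hX 1 i j with hb | ⟨k, l, p, q, -, hle⟩
  · rw [hb] at h
    exact not_lt_bot h
  have h1 : A i j < (c : Rmax) + pow (shift c X)
      (cyclicity (critArc X) * p + (1 + cyclicity (critArc X) * q)) i j := by
    refine h.trans_le (hle.trans ?_)
    rw [Nat.cast_one, one_mul]
    exact add_le_add le_rfl ((add_le_add le_rfl (pow_add_le _ _ _ _ _ _)).trans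
      (pow_add_le _ _ _ _ _ _))
  set m := cyclicity (critArc X) * p + (1 + cyclicity (critArc X) * q)
  rw [← add_shift c A i j] at h1
  have h2 : shift c A i j < pow (shift c A) m i j := by
    refine lt_of_not_ge fun hge => absurd h1 (not_lt_of_ge (add_le_add le_rfl ?_))
    exact (pow_mono (shift_mono c hXA) m i j).trans hge
  have hsb : pow (shift c A) s j i ≠ ⊥ := fun hb => by
    rw [hb] at hs
    exact ne_bot_of_nonneg hs (by simp)
  have h3 : shift c A i j + pow (shift c A) s j i < pow (shift c A) m i j +
      pow (shift c A) s j i := WithBot.add_lt_add_right hsb h2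
  exact absurd (hs.trans_lt (h3.trans_le (pow_add_le _ _ _ _ _ _)))
    (not_lt_of_ge (pow_shift_self_nonpos hA _ _))

theorem A1_ne_bot {A : Mat n} {g : ℕ} {i j : Fin n} (h : A1 A g i j ≠ ⊥) :
    j.val = i.val + 1 ∨ (i.val = n - 1 ∧ j.val = 0) ∨ (i.val = g - 1 ∧ j.val = 0) := by
  by_contra hc
  exact h (if_neg hc)

theorem A1_le (A : Mat n) (g : ℕ) (i j : Fin n) : A1 A g i j ≤ A i j := by
  unfold A1
  split_ifs
  · exact le_rfl
  · exact bot_le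

theorem B1_le (A : Mat n) (g : ℕ) (i j : Fin n) : B1 A g i j ≤ A i j := by
  unfold B1
  split_ifs
  · exact le_rfl
  · exact bot_le

theorem exists_lam_eq {A : Mat n} {i j : Fin n} (h : critArc A i j) : ∃ c : ℝ, lam A = c := by
  obtain ⟨W, ⟨hW, hm⟩, -⟩ := h
  have hne : lam A ≠ ⊥ := by
    rw [← hm, mean, ne_eq, WithBot.map_eq_bot_iff]
    exact weight_ne_bot_of_isChain hW.2.1
  exact ⟨(lam A).unbot hne, (WithBot.coe_unbot _ _).symm⟩

/-- Critical arcs of `A` stay critical in a matrix agreeing with `A` on them. -/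
theorem critArc_of_eq_on_critArc {A E : Mat n} {c : ℝ} (hA : lam A = c) (hE : lam E = c)
    (hAE : ∀ i j, critArc A i j → E i j = A i j) {i j : Fin n} (h : critArc A i j) :
    critArc E i j := by
  obtain ⟨W, hW, hij⟩ := h
  refine ⟨W, ?_, hij⟩
  obtain ⟨k, l, rfl, hn, h0⟩ := (isCritCycle_iff hA W).1 hW
  refine (isCritCycle_iff hE _).2 ⟨k, l, rfl, hn, h0.trans_eq (weight_congr fun p hp => ?_)⟩
  rw [shift_apply, shift_apply, hAE p.1 p.2 ⟨_, hW, hp⟩]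

/-- A path from a node outside of a set to a node of the set enters the set. -/
theorem exists_entering_arc {α : Type*} {R : α → α → Prop} {P : α → Prop} {x y : α}
    (h : Relation.ReflTransGen R x y) (hx : ¬ P x) (hy : P y) : ∃ u v, R u v ∧ ¬ P u ∧ P v := by
  induction h with
  | refl => exact absurd hy hx
  | @tail b d _ hbd ih =>
    by_cases hb : P b
    · exact ih hb
    · exact ⟨b, d, hbd, hb, hy⟩

theorem shift_oplus_le_pow {A : Mat n} {g : ℕ} {c : ℝ} (hA : lam A = c)
    {i j : Fin n} (hij : i.val + 1 < j.val)
    (h : (j.val - i.val - 1) • lam A + B1 A g i j < pow (A1 A g) (j.val - i.val) i j) :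
    shift c (oplus (A1 A g) (B1 A g)) i j ≤ pow (shift c (A1 A g)) (j.val - i.val) i j := by
  have hbot : A1 A g i j = ⊥ := by
    by_contra hb
    rcases A1_ne_bot hb with h | ⟨-, h⟩ | ⟨-, h⟩ <;> omega
  have hE : shift c (oplus (A1 A g) (B1 A g)) i j = shift c (B1 A g) i j := by
    rw [shift_apply, shift_apply, oplus, hbot, max_eq_right bot_le]
  rw [hE]
  obtain ⟨d, hd⟩ : ∃ d, j.val - i.val = d + 1 := ⟨j.val - i.val - 1, by omega⟩
  rw [hd, Nat.add_sub_cancel, hA, pow_eq_add_pow_shift c, ← add_shift c (B1 A g) i j, ← add_assoc,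
    ← succ_nsmul, ← WithBot.coe_nsmul, nsmul_eq_mul] at h
  rw [hd]
  exact (lt_of_add_lt_add_left h).le

theorem oplus_le_or (A : Mat n) (g : ℕ) (c : ℝ) (i j : Fin n) :
    shift c (oplus (A1 A g) (B1 A g)) i j ≤ shift c (A1 A g) i j ∨
      g ≤ i.val ∧ g ≤ j.val ∧ j.val ≡ i.val + 1 [MOD g] ∧ (j.val ≤ i.val ∨ i.val + 1 < j.val) := by
  rw [or_iff_not_imp_left]
  intro hlt
  rw [shift_apply, shift_apply] at hlt
  have h1 : ¬ B1 A g i j ≤ A1 A g i j := fun h => hlt (add_le_add le_rfl (max_le le_rfl h))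
  have h2 : j.val ≠ i.val + 1 := fun h => h1 ((B1_le A g i j).trans_eq (if_pos (Or.inl h)).symm)
  have h3 : g ≤ i.val ∧ g ≤ j.val ∧ j.val % g = (i.val + 1) % g := by
    by_contra hc
    exact h1 ((if_neg hc : B1 A g i j = ⊥).trans_le bot_le)
  exact ⟨h3.1, h3.2.1, h3.2.2, by omega⟩

theorem A1_ne_bot_of_lt {A : Mat n} {g : ℕ} {i j : Fin n}
    (h : oplus (A1 A g) (B1 A g) i j ≠ ⊥) (hij : i.val < g ∨ j.val < g) : A1 A g i j ≠ ⊥ := by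
  intro hb
  have hB : B1 A g i j = ⊥ := if_neg fun hc => by omega
  exact h (by rw [oplus, hb, hB, max_self])

theorem oplus_eq_of_ne_bot {A : Mat n} {g : ℕ} {i j : Fin n}
    (h : oplus (A1 A g) (B1 A g) i j ≠ ⊥) : oplus (A1 A g) (B1 A g) i j = A i j := by
  unfold oplus A1 B1 at *
  split_ifs at * <;> simp_all

/-- The critical graphs of `A₁` and `A₁ ⊕ B₁` have the same cyclicity, dividing `g`, and each
critical node lies on a critical closed walk through the first node with length divisible by the
cyclicity. -/
theorem exists_cyclicity_eq {A : Mat n} {g : ℕ} {c : ℝ} (hg : 2 ≤ g) (hgn : g < n)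
    (h2 : mLt (A2 A g) (csr (A1 A g) 1))
    (hSC : ∀ i j, critNode A i → critNode A j → reach (critArc A) i j)
    (hcop : Nat.Coprime g n)
    (hA : lam A = c) (hA1 : lam (A1 A g) = c) (hE : lam (oplus (A1 A g) (B1 A g)) = c)
    (hfrom : ∀ z : Fin n, z.val = 0 → ∀ b j, ∃ b',
      pow (shift c (oplus (A1 A g) (B1 A g))) b z j ≤ pow (shift c (A1 A g)) b' z j)
    {z p : Fin n} (hz : z.val = 0) (hp : p.val + 1 = g) (hzA : critNode A z)
    (h0 : 0 ≤ pow (shift c (A1 A g)) p.val z p + shift c (A1 A g) p z) :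
    ∃ γ, γ ∣ g ∧ ∀ X, X = A1 A g ∨ X = oplus (A1 A g) (B1 A g) →
      cyclicity (critArc X) = γ ∧ ∀ k, critNode X k → ∃ a b, γ ∣ a + b ∧
        0 ≤ pow (shift c X) a k z + pow (shift c X) b z k := by
  set E := oplus (A1 A g) (B1 A g) with hEd
  have hA1E : ∀ i j, A1 A g i j ≤ E i j := fun i j => le_max_left _ _
  have hEA : ∀ i j, E i j ≤ A i j := fun i j => max_le (A1_le A g i j) (B1_le A g i j)
  have hY : ∀ i j : Fin n, 0 < j.val → shift c (A1 A g) i j ≠ ⊥ → j.val = i.val + 1 := by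
    intro i j hj hb
    rcases A1_ne_bot (mt shift_eq_bot.2 hb) with h | ⟨-, h⟩ | ⟨-, h⟩ <;> omega
  have hlam : ∀ X, X = A1 A g ∨ X = E → lam X = c := by
    rintro X (rfl | rfl)
    exacts [hA1, hE]
  have hle : ∀ X, X = A1 A g ∨ X = E → ∀ i j, A1 A g i j ≤ X i j := by
    rintro X (rfl | rfl)
    exacts [fun _ _ => le_rfl, hA1E]
  have hcons : ∀ X, X = A1 A g ∨ X = E → _ := fun X hX =>
    std_cycle_consequences (hlam X hX) (shift_mono c (hle X hX)) hY hz h0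
  let q : Fin n := ⟨n - 1, by omega⟩
  by_cases hN : 0 ≤ pow (shift c (A1 A g)) q.val z q + shift c (A1 A g) q z
  · refine ⟨1, one_dvd _, fun X hX => ?_⟩
    have hcn := std_cycle_consequences (hlam X hX) (shift_mono c (hle X hX)) hY hz hN
    have hcg := (hcons X hX).2
    have hq : q.val + 1 = n := by change n - 1 + 1 = n; omega
    rw [hq] at hcn
    rw [hp] at hcg
    refine ⟨cyclicity_eq_one (by omega) hgn.le hcop hcg hcn.2, fun k _ => ?_⟩
    obtain ⟨a, b, -, hab⟩ := hcn.1 k k.isLt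
    exact ⟨a, b, one_dvd _, hab⟩
  · have harc : ∀ i j, critArc A i j → E i j = A i j := by
      intro i j hij
      by_contra hne
      have hb : E i j = ⊥ := by
        by_contra hb
        exact hne (oplus_eq_of_ne_bot hb)
      have h2' : A2 A g i j = A i j := if_neg (not_not.2 hb)
      rcases h2 i j with h | ⟨h, -⟩
      · rw [h2'] at h
        exact not_critArc_of_lt_csr hA hA1 (A1_le A g) h hij
      · rw [h2'] at h
        exact ne_bot_of_critArc hA hij h
    have hnode : ∀ k, critNode E k → k.val < g := by
      intro k hk
      by_contra hkg
      obtain ⟨u, v, huv, hu, hv⟩ := exists_entering_arc (P := fun x : Fin n => x.val < g)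
        (reflTransGen_of_reach (hSC k z (critNode_mono hEA hE hA hk) hzA)) hkg
        (by omega)
      have huvE := critArc_of_eq_on_critArc hA hE harc huv
      have huv1 := A1_ne_bot (A1_ne_bot_of_lt (ne_bot_of_critArc hE huvE) (Or.inr hv))
      have hqz : u = q ∧ v = z := by
        rcases huv1 with h | ⟨h, h'⟩ | ⟨h, h'⟩
        · omega
        · exact ⟨Fin.ext h, Fin.ext (h'.trans hz.symm)⟩
        · omega
      obtain ⟨rfl, rfl⟩ := hqz
      obtain ⟨s, hs⟩ := exists_return_of_critArc hE huvE
      obtain ⟨b', hb'⟩ := hfrom v hz s q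
      have hEq : shift c E q v = shift c (A1 A g) q v := by
        have hB : B1 A g q v = ⊥ := if_neg fun hc => by omega
        rw [shift_apply, shift_apply, hEd, oplus, hB, max_eq_left bot_le]
      rw [hEq] at hs
      rcases pow_split_in hY hz q.val b' v q (by omega) with h | ⟨-, h⟩
      · rw [h, le_bot_iff] at hb'
        rw [hb', WithBot.add_bot] at hs
        exact ne_bot_of_nonneg hs rfl
      · refine hN (hs.trans ?_)
        rw [add_comm]
        refine add_le_add (hb'.trans (h.trans ?_)) le_rfl
        exact (add_le_add (pow_shift_self_nonpos hA1 _ _) le_rfl).trans (by simp)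
    refine ⟨g, dvd_rfl, fun X hX => ?_⟩
    have hXE : ∀ i j, X i j ≤ E i j := by
      rcases hX with rfl | rfl
      exacts [hA1E, fun _ _ => le_rfl]
    have hcg := hcons X hX
    rw [hp] at hcg
    refine ⟨cyclicity_eq_of_mod (by omega) hgn.le hcg.2 fun i j hij => ?_, fun k hk => ?_⟩
    · have hij' := critArc_mono hXE (hlam X hX) hE hij
      have hi := hnode i (critArc_left hij')
      have hj := hnode j (critArc_right hij')
      refine ⟨hi, hj, ?_⟩
      rcases A1_ne_bot (A1_ne_bot_of_lt (ne_bot_of_critArc hE hij') (Or.inl hi)) with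
        h | ⟨h, -⟩ | ⟨h, h'⟩
      · rw [h]
      · omega
      · rw [h', h, show g - 1 + 1 = g by omega]
        exact ((Nat.modEq_zero_iff_dvd).2 dvd_rfl).symm
    · obtain ⟨a, b, hab, h⟩ := hcg.1 k (hnode k (critNode_mono hXE (hlam X hX) hE hk))
      exact ⟨a, b, hab ▸ dvd_rfl, h⟩

end MaxPlus

namespace MaxPlus

/-- Lemma 4.18: if `A₂ < CSR[A₁]`, `C(A)` is strongly connected and contains the cycle
`1⋯g1`, `g` and `n` are coprime, and `B₁` satisfies Condition 3 of Theorem 3.1, then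
`CS^tR[A₁] = CS^tR[A₁ ⊕ B₁]` for all `t`. -/
theorem csr_A1_eq_csr_A1_oplus_B1 {n : ℕ} (A : Mat n) (g : ℕ)
    (hg : 2 ≤ g) (hgn : g ≤ n)
    (h2 : mLt (A2 A g) (csr (A1 A g) 1))
    (hSC : ∀ i j, critNode A i → critNode A j → reach (critArc A) i j)
    (hcyc : IsCycle (critArc A) (stdCyc n g))
    (hcop : Nat.Coprime g n)
    (h3 : ∀ i j : Fin n, i.val + 1 < j.val → g ≤ i.val → j.val % g = (i.val + 1) % g →
      (j.val - i.val - 1) • lam A + B1 A g i j < pow (A1 A g) (j.val - i.val) i j) :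
    ∀ t : ℕ, csr (A1 A g) t = csr (oplus (A1 A g) (B1 A g)) t := by
  have hgn' : g < n := by
    refine lt_of_le_of_ne hgn ?_
    rintro rfl
    rw [Nat.coprime_self] at hcop
    omega
  let z : Fin n := ⟨0, by omega⟩
  let p : Fin n := ⟨g - 1, by omega⟩
  have hp : p.val + 1 = g := by change g - 1 + 1 = g; omega
  obtain ⟨harc₁, harc₂⟩ := arc_of_isCycle_stdCyc (by omega) hgn hcyc
  have hpz : critArc A p z := harc₂ p z rfl rfl
  obtain ⟨c, hA⟩ := exists_lam_eq hpz
  set E := oplus (A1 A g) (B1 A g) with hEd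
  have hA1E : ∀ i j, A1 A g i j ≤ E i j := fun i j => le_max_left _ _
  have hEA : ∀ i j, E i j ≤ A i j := fun i j => max_le (A1_le A g i j) (B1_le A g i j)
  have hY : ∀ i j : Fin n, 0 < j.val → shift c (A1 A g) i j ≠ ⊥ → j.val = i.val + 1 := by
    intro i j hj hb
    rcases A1_ne_bot (mt shift_eq_bot.2 hb) with h | ⟨-, h⟩ | ⟨-, h⟩ <;> omega
  have hY' : ∀ i j : Fin n, g ≤ i.val → i.val + 1 < n → shift c (A1 A g) i j ≠ ⊥ →
      j.val = i.val + 1 := by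
    intro i j hi hin hb
    rcases A1_ne_bot (mt shift_eq_bot.2 hb) with h | ⟨h, -⟩ | ⟨h, -⟩ <;> omega
  have h0 : 0 ≤ pow (shift c (A1 A g)) p.val z p + shift c (A1 A g) p z := by
    refine nonneg_of_critical_std_cycle hA rfl (fun i j hij hj => ?_) ⟨hpz, ?_⟩
    · refine ⟨harc₁ i j hij (by omega), ?_⟩
      rw [shift_apply, shift_apply, A1, if_pos (Or.inl hij)]
    · rw [shift_apply, shift_apply, A1, if_pos (Or.inr (Or.inr ⟨rfl, rfl⟩))]
  have h0Y : 0 ≤ pow (shift c (A1 A g)) (p.val + 1) z z := h0.trans (pow_succ_le _ _ _ _ _)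
  have h0Z : 0 ≤ pow (shift c E) (p.val + 1) z z :=
    h0Y.trans (pow_mono (shift_mono c hA1E) _ _ _)
  have hA1 : lam (A1 A g) = c := lam_eq_of_le (A1_le A g) hA h0Y
  have hE : lam E = c := lam_eq_of_le hEA hA h0Z
  rw [hp] at h0Y h0Z
  have hf : ∀ i j : Fin n, i.val + 1 < j.val → g ≤ i.val → j.val ≡ i.val + 1 [MOD g] →
      shift c E i j ≤ pow (shift c (A1 A g)) (j.val - i.val) i j := fun i j hij hi hm =>
    shift_oplus_le_pow hA hij (h3 i j hij hi hm)
  have hfrom := fun (z : Fin n) (hz : z.val = 0) => pow_le_pow_from hz (pow_shift_self_nonpos hA)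
    (shift_mono c (A1_le A g)) (shift_mono c hEA) hY
    (fun i j => (oplus_le_or A g c i j).imp_right fun h => ⟨h.1, h.2.2⟩) hf
  have hto := pow_le_pow_to (z := z) (by change 0 < g; omega) (pow_shift_self_nonpos hA)
    (shift_mono c (A1_le A g)) (shift_mono c hEA) hY' (oplus_le_or A g c) hf
  obtain ⟨γ, hγ, hX⟩ := exists_cyclicity_eq hg hgn' h2 hSC hcop hA hA1 hE
    (fun z hz b j => (hfrom z hz b j).imp fun _ h => h.2) rfl hp (critArc_right hpz) h0
  obtain ⟨hγ₁, hz₁⟩ := hX _ (Or.inl rfl)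
  obtain ⟨hγ₂, hz₂⟩ := hX _ (Or.inr rfl)
  rw [← hEd] at hγ₂ hz₂
  intro t
  funext i j
  apply le_antisymm
  · rcases csr_le_walk hA1 (by rwa [hγ₁]) t i j with h | ⟨a, b, hab, h⟩
    · exact h ▸ bot_le
    · rw [hγ₁, ← hγ₂] at hab
      refine h.trans (le_trans ?_ (walk_le_csr hE (by omega) (hγ₂ ▸ hγ) h0Z hab i j))
      exact add_le_add le_rfl (add_le_add (pow_mono (shift_mono c hA1E) _ _ _)
        (pow_mono (shift_mono c hA1E) _ _ _))
  · rcases csr_le_walk hE (by rwa [hγ₂]) t i j with h | ⟨a, b, hab, h⟩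
    · exact h ▸ bot_le
    · obtain ⟨a', ha', hle⟩ := hto a i
      obtain ⟨b', hb', hle'⟩ := hfrom z rfl b j
      rw [hγ₂] at hab
      have hab' : a' + b' ≡ t [MOD cyclicity (critArc (A1 A g))] := by
        rw [hγ₁]
        exact ((ha'.add hb').of_dvd hγ).trans hab
      refine h.trans (le_trans ?_ (walk_le_csr hA1 (by omega) (hγ₁ ▸ hγ) h0Y hab' i j))
      exact add_le_add le_rfl (add_le_add hle hle')

end MaxPlus
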